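/- The canonical map χ : A(S^7_q) ⊗_{A(Σ^4_q)} A(S^7_q) → A(S^7_q) ⊗ C, χ(p' ⊗ p) = Σ p' p_(0) ⊗ r(p_(1)), is bijective; hence A(Σ^4_q) ⊆ A(S^7_q) is a coalgebra-Galois extension by C. -/

import Mathlib

open scoped TensorProduct

noncomputable section

namespace QIB

/-- Generators of `A(U_q(4))`: the matrix entries `t i j` and the extra generator `D_q⁻¹`. -/
abbrev genU : Type := (Fin 4 × Fin 4) ⊕ Unit

abbrev FU : Type := FreeAlgebra ℂ genU

def T (i j : Fin 4) : FU := FreeAlgebra.ι ℂ (Sum.inl (i, j))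

def Dinv0 : FU := FreeAlgebra.ι ℂ (Sum.inr ())

/-- The length (number of inversions) of a permutation of `Fin 4`. -/
def plen (σ : Equiv.Perm (Fin 4)) : ℕ :=
  ((Finset.univ : Finset (Fin 4 × Fin 4)).filter fun p => p.1 < p.2 ∧ σ p.2 < σ p.1).card

/-- The quantum determinant, as an element of the free algebra. -/
def Dq0 (q : ℝ) : FU :=
  ∑ σ : Equiv.Perm (Fin 4),
    ((-(q : ℂ)) ^ plen σ) • (T (σ 0) 0 * T (σ 1) 1 * T (σ 2) 2 * T (σ 3) 3)

/-- The defining relations of `A(U_q(4))`. -/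
inductive relU (q : ℝ) : FU → FU → Prop
  | col {i j k : Fin 4} : i < j → relU q (T i k * T j k) ((q : ℂ) • (T j k * T i k))
  | row {i j k : Fin 4} : i < j → relU q (T k i * T k j) ((q : ℂ) • (T k j * T k i))
  | comm {i j k l : Fin 4} : i < j → k < l → relU q (T i l * T j k) (T j k * T i l)
  | qcom {i j k l : Fin 4} : i < j → k < l →
      relU q (T i k * T j l - T j l * T i k) (((q : ℂ) - (q : ℂ)⁻¹) • (T j k * T i l))
  | dr : relU q (Dq0 q * Dinv0) 1
  | dl : relU q (Dinv0 * Dq0 q) 1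

variable (q : ℝ)

/-- The algebra `A(U_q(4))`. -/
abbrev AU : Type := RingQuot (relU q)

/-- The generators `t i j` of `A(U_q(4))` (indices are 0-based). -/
def tt (i j : Fin 4) : AU q := RingQuot.mkAlgHom ℂ (relU q) (T i j)

/-- The generator `D_q⁻¹`. -/
def dI : AU q := RingQuot.mkAlgHom ℂ (relU q) Dinv0

/-- The quantum determinant `D_q` in `A(U_q(4))`. -/
def Dq : AU q := RingQuot.mkAlgHom ℂ (relU q) (Dq0 q)

/-- The spanning set `R` of relation elements (0-based indices). -/
def Rset : Set (AU q) :=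
  {tt q 0 2, tt q 2 0, tt q 0 3, tt q 3 0, tt q 1 3, tt q 3 1, tt q 1 2, tt q 2 1,
   tt q 0 0 - tt q 3 3, tt q 0 1 + tt q 3 2, tt q 1 0 + tt q 2 3, tt q 1 1 - tt q 2 2,
   tt q 0 0 * tt q 1 1 - (q : ℂ) • (tt q 0 1 * tt q 1 0) - 1}

/-- The right ideal `ℛ = R · A(U_q(4))`, as a `ℂ`-submodule. -/
def RIdeal : Submodule ℂ (AU q) :=
  Submodule.span ℂ {y | ∃ x ∈ Rset q, ∃ a : AU q, y = x * a}

/-- The coalgebra `C = A(U_q(4)) / ℛ`. -/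
abbrev Cq : Type := AU q ⧸ RIdeal q

/-- The canonical projection `r : A(U_q(4)) → C`. -/
def rr : AU q →ₗ[ℂ] Cq q := (RIdeal q).mkQ

lemma RIdeal_mul_right {y : AU q} (hy : y ∈ RIdeal q) (c : AU q) : y * c ∈ RIdeal q := by
  induction hy using Submodule.span_induction with
  | mem x hx =>
      obtain ⟨x0, hx0, a, rfl⟩ := hx
      exact Submodule.subset_span ⟨x0, hx0, a * c, by rw [mul_assoc]⟩
  | zero => simp
  | add u v _ _ hu hv => simpa [add_mul] using (RIdeal q).add_mem hu hv
  | smul a u _ hu => simpa [smul_mul_assoc] using (RIdeal q).smul_mem a hu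

/-- Auxiliary map for the right `A(U_q(4))`-module structure of `C`:
right multiplication by `c` descends to the quotient. -/
def cactAux (c : AU q) : Cq q →ₗ[ℂ] Cq q :=
  Submodule.liftQ (RIdeal q) ((RIdeal q).mkQ ∘ₗ LinearMap.mulRight ℂ c)
    (by
      intro y hy
      simp only [LinearMap.mem_ker, LinearMap.comp_apply, LinearMap.mulRight_apply,
        Submodule.mkQ_apply, Submodule.Quotient.mk_eq_zero]
      exact RIdeal_mul_right q hy c)

@[simp] lemma cactAux_mk (c a : AU q) :
    cactAux q c (Submodule.Quotient.mk a) = (Submodule.Quotient.mk (a * c) : Cq q) := by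
  simp [cactAux]

/-- The right `A(U_q(4))`-module structure `r(t) · t' := r(t t')` of `C`,
as a bilinear map `A(U_q(4)) →ₗ C →ₗ C`, `(c, x) ↦ x · c`. -/
def cact : AU q →ₗ[ℂ] Cq q →ₗ[ℂ] Cq q where
  toFun c := cactAux q c
  map_add' c c' := by
    refine LinearMap.ext fun x => ?_
    obtain ⟨a, rfl⟩ := Submodule.Quotient.mk_surjective _ x
    simp only [cactAux_mk, mul_add, Submodule.Quotient.mk_add, LinearMap.add_apply]
  map_smul' s c := by
    refine LinearMap.ext fun x => ?_
    obtain ⟨a, rfl⟩ := Submodule.Quotient.mk_surjective _ x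
    simp only [cactAux_mk, mul_smul_comm, Submodule.Quotient.mk_smul, RingHom.id_apply, LinearMap.smul_apply]

@[simp] lemma cact_mk (c a : AU q) : cact q c (rr q a) = rr q (a * c) := by
  simp [cact, rr]

/-- θ(k) = 1 for k ≥ 0 and 0 for k < 0. -/
def thetaZ (k : ℤ) : ℂ := if 0 ≤ k then 1 else 0

/-- The linear basis elements `r^{k,m,n}` of `C`, given as representatives in `A(U_q(4))`. -/
def bas (k : ℤ) (m n : ℕ) : AU q :=
  if 0 ≤ k then tt q 0 0 ^ k.toNat * tt q 0 1 ^ m * tt q 1 0 ^ n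
  else tt q 0 1 ^ m * tt q 1 0 ^ n * tt q 1 1 ^ (-k).toNat

/-! ### The quantum seven-sphere -/

/-- Generators of `A(S⁷_q)`: `(i, false)` is `z_i`, `(i, true)` is `z_i^*`. -/
abbrev genS : Type := Fin 4 × Bool

abbrev FS : Type := FreeAlgebra ℂ genS

def Z0 (i : Fin 4) : FS := FreeAlgebra.ι ℂ (i, false)

def Zs0 (i : Fin 4) : FS := FreeAlgebra.ι ℂ (i, true)

/-- The defining relations of the ∗-algebra `A(S⁷_q)` (including the ∗-conjugate of the
first family of relations, so that the relation set is closed under the involution). -/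
inductive relS (q : ℝ) : FS → FS → Prop
  | zz {i j : Fin 4} : i < j → relS q (Z0 i * Z0 j) ((q : ℂ) • (Z0 j * Z0 i))
  | ss {i j : Fin 4} : i < j → relS q (Zs0 j * Zs0 i) ((q : ℂ) • (Zs0 i * Zs0 j))
  | sz {i j : Fin 4} : i ≠ j → relS q (Zs0 j * Z0 i) ((q : ℂ) • (Z0 i * Zs0 j))
  | szz {k : Fin 4} : relS q (Zs0 k * Z0 k)
      (Z0 k * Zs0 k + (1 - (q : ℂ) ^ 2) •
        ∑ j ∈ Finset.univ.filter (· < k), Z0 j * Zs0 j)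
  | sum1 : relS q (∑ k : Fin 4, Z0 k * Zs0 k) 1

/-- The algebra `P = A(S⁷_q)`. -/
abbrev PA : Type := RingQuot (relS q)

/-- The generators `z_i` of `A(S⁷_q)` (0-based index). -/
def z (i : Fin 4) : PA q := RingQuot.mkAlgHom ℂ (relS q) (Z0 i)

/-- The generators `z_i^*` of `A(S⁷_q)` (0-based index). -/
def zs (i : Fin 4) : PA q := RingQuot.mkAlgHom ℂ (relS q) (Zs0 i)

/-- The element `R = z₁ z₁^* + z₂ z₂^*` of `A(S⁷_q)`. -/
def RRe [StarRing (PA q)] : PA q := z q 0 * star (z q 0) + z q 1 * star (z q 1)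

/-- The element `a = z₁ z₄^* − z₂ z₃^*` of `A(S⁷_q)`. -/
def aa [StarRing (PA q)] : PA q := z q 0 * star (z q 3) - z q 1 * star (z q 2)

/-- The element `b = z₁ z₃ + q⁻¹ z₂ z₄` of `A(S⁷_q)`. -/
def bb : PA q := z q 0 * z q 2 + (q : ℂ)⁻¹ • (z q 1 * z q 3)

/-- The elements `a_n = z₁ z₄^* − qⁿ z₂ z₃^*` of `A(S⁷_q)`. -/
def aN [StarRing (PA q)] (n : ℤ) : PA q :=
  z q 0 * star (z q 3) - ((q : ℂ) ^ n) • (z q 1 * star (z q 2))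

/-- The elements `b_n = z₁ z₃ + q^{n−1} z₂ z₄` of `A(S⁷_q)`. -/
def bN (n : ℤ) : PA q := z q 0 * z q 2 + ((q : ℂ) ^ (n - 1)) • (z q 1 * z q 3)

/-! ### The coaction, the coinvariants and the canonical map -/

variable (δ : PA q →ₐ[ℂ] PA q ⊗[ℂ] AU q)

/-- `Δ_r := (id ⊗ r) ∘ Δ : A(S⁷_q) → A(S⁷_q) ⊗ C`, built from the
`A(U_q(4))`-coaction `δ`. -/
def Dr : PA q →ₗ[ℂ] PA q ⊗[ℂ] Cq q :=
  (LinearMap.lTensor (PA q) (rr q)) ∘ₗ δ.toLinearMap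

/-- The set of coinvariants `B = A(Σ⁴_q) = {a | Δ_r(a) = a ⊗ r(1)}`. -/
def Bset : Set (PA q) := {a : PA q | Dr q δ a = a ⊗ₜ[ℂ] rr q 1}

/-- The subspace of `P ⊗ P` spanned by the elements `(u b) ⊗ v − u ⊗ (b v)` with `b`
a coinvariant; quotienting by it produces the balanced tensor product `P ⊗_B P`. -/
def relT : Submodule ℂ (PA q ⊗[ℂ] PA q) :=
  Submodule.span ℂ
    {x : PA q ⊗[ℂ] PA q | ∃ u v b : PA q, b ∈ Bset q δ ∧
      x = (u * b) ⊗ₜ[ℂ] v - u ⊗ₜ[ℂ] (b * v)}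

set_option maxSynthPendingDepth 3

/-- The balanced tensor product `P ⊗_B P` over the coinvariant subalgebra `B = A(Σ⁴_q)`. -/
abbrev PBP : Type := (PA q ⊗[ℂ] PA q) ⧸ relT q δ

/-- The canonical projection `P ⊗ P → P ⊗_B P`. -/
def mkT : PA q ⊗[ℂ] PA q →ₗ[ℂ] PBP q δ := (relT q δ).mkQ

lemma relT_map_lmul (p : PA q) {x : PA q ⊗[ℂ] PA q} (hx : x ∈ relT q δ) :
    TensorProduct.map (LinearMap.mulLeft ℂ p) LinearMap.id x ∈ relT q δ := by
  induction hx using Submodule.span_induction with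
  | mem y hy =>
      obtain ⟨u, v, b, hb, rfl⟩ := hy
      refine Submodule.subset_span ⟨p * u, v, b, hb, ?_⟩
      simp [TensorProduct.map_tmul, mul_assoc]
  | zero => simp
  | add u v _ _ hu hv => simpa [map_add] using Submodule.add_mem _ hu hv
  | smul a u _ hu => simpa [map_smul] using Submodule.smul_mem _ a hu

lemma relT_map_rmul (p : PA q) {x : PA q ⊗[ℂ] PA q} (hx : x ∈ relT q δ) :
    TensorProduct.map LinearMap.id (LinearMap.mulRight ℂ p) x ∈ relT q δ := by
  induction hx using Submodule.span_induction with
  | mem y hy =>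
      obtain ⟨u, v, b, hb, rfl⟩ := hy
      refine Submodule.subset_span ⟨u, v * p, b, hb, ?_⟩
      simp [TensorProduct.map_tmul, mul_assoc]
  | zero => simp
  | add u v _ _ hu hv => simpa [map_add] using Submodule.add_mem _ hu hv
  | smul a u _ hu => simpa [map_smul] using Submodule.smul_mem _ a hu

/-- Left multiplication by `p ∈ P` on the bimodule `P ⊗_B P`. -/
def lact (p : PA q) : PBP q δ →ₗ[ℂ] PBP q δ :=
  Submodule.liftQ (relT q δ)
    ((relT q δ).mkQ ∘ₗ TensorProduct.map (LinearMap.mulLeft ℂ p) LinearMap.id)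
    (by
      intro x hx
      simp only [LinearMap.mem_ker, LinearMap.comp_apply, Submodule.mkQ_apply,
        Submodule.Quotient.mk_eq_zero]
      exact relT_map_lmul q δ p hx)

/-- Right multiplication by `p ∈ P` on the bimodule `P ⊗_B P`. -/
def ract (p : PA q) : PBP q δ →ₗ[ℂ] PBP q δ :=
  Submodule.liftQ (relT q δ)
    ((relT q δ).mkQ ∘ₗ TensorProduct.map LinearMap.id (LinearMap.mulRight ℂ p))
    (by
      intro x hx
      simp only [LinearMap.mem_ker, LinearMap.comp_apply, Submodule.mkQ_apply,
        Submodule.Quotient.mk_eq_zero]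
      exact relT_map_rmul q δ p hx)

/-- The structure map of the right action `◁` of `A(S⁷_q)` on `A(S⁷_q) ⊗ C`:
on simple tensors, `(u ⊗ x) ⊗ (w ⊗ y) ↦ (u w) ⊗ (x · y)`.  The action is
`(u ⊗ x) ◁ v = triMap ((u ⊗ x) ⊗ δ v) = Σ u v₍₀₎ ⊗ x · v₍₁₎`. -/
def triMap : (PA q ⊗[ℂ] Cq q) ⊗[ℂ] (PA q ⊗[ℂ] AU q) →ₗ[ℂ] PA q ⊗[ℂ] Cq q :=
  (TensorProduct.map (LinearMap.mul' ℂ (PA q)) (TensorProduct.lift (LinearMap.flip (cact q)))) ∘ₗ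
    (TensorProduct.tensorTensorTensorComm ℂ (PA q) (Cq q) (PA q) (AU q)).toLinearMap

/-! ### Part A1 -/

open Polynomial in
/-- The substitution `X ↦ c X`. -/
def sc (c : ℂ) : Polynomial ℂ →ₐ[ℂ] Polynomial ℂ := aeval (C c * X)

open Polynomial in
lemma sc_sc (c c' : ℂ) (Q : ℂ[X]) : sc c (sc c' Q) = sc (c * c') Q := by
  have : (sc c).comp (sc c') = sc (c * c') := by
    apply Polynomial.algHom_ext
    simp only [sc, AlgHom.comp_apply, aeval_X, map_mul, aeval_C, Polynomial.algebraMap_eq]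
    ring
  exact congrArg (fun f => f Q) this

open Polynomial in
lemma sc_one (Q : ℂ[X]) : sc 1 Q = Q := by
  have : sc 1 = AlgHom.id ℂ _ := by
    apply Polynomial.algHom_ext
    simp [sc]
  rw [this]; rfl

open Polynomial in
lemma sc_comm (c c' : ℂ) (Q : ℂ[X]) : sc c (sc c' Q) = sc c' (sc c Q) := by
  rw [sc_sc, sc_sc, mul_comm]

open Polynomial in
/-- Localized semilinear maps. -/
theorem exists_locMap {W : Type} [AddCommGroup W] [Module ℂ W] [Module ℂ[X] W]
    [IsScalarTower ℂ ℂ[X] W] (S : Submonoid ℂ[X]) (c : ℂ)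
    (hS : ∀ s ∈ S, sc c s ∈ S) (f : W →ₗ[ℂ] W)
    (hf : ∀ (Q : ℂ[X]) (w : W), f (Q • w) = sc c Q • f w) :
    ∃ F : LocalizedModule S W →ₗ[ℂ] LocalizedModule S W,
      (∀ w, F (LocalizedModule.mkLinearMap S W w) = LocalizedModule.mkLinearMap S W (f w)) ∧
      ∀ (Q : ℂ[X]) w, F (Q • w) = sc c Q • F w := by
  let θ : S → S := fun s => ⟨sc c s, hS s s.2⟩
  have hfS : ∀ (s : S) (w : W), f (s • w) = θ s • f w := fun s w => hf s w
  have wd : ∀ (p p' : W × S), p ≈ p' →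
      (fun p : W × S => LocalizedModule.mk (f p.1) (θ p.2)) p =
      (fun p : W × S => LocalizedModule.mk (f p.1) (θ p.2)) p' := by
    rintro ⟨w, s⟩ ⟨w', s'⟩ h
    obtain ⟨u, hu⟩ := h
    show LocalizedModule.mk _ _ = LocalizedModule.mk _ _
    rw [LocalizedModule.mk_eq]
    refine ⟨θ u, ?_⟩
    have := congrArg f hu
    simpa only [hfS] using this
  let F0 : LocalizedModule S W → LocalizedModule S W := fun x => x.liftOn _ wd
  have hF0 : ∀ w s, F0 (LocalizedModule.mk w s) = LocalizedModule.mk (f w) (θ s) :=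
    fun w s => LocalizedModule.liftOn_mk wd w s
  have hθ : ∀ s t : S, θ (s * t) = θ s * θ t := by
    intro s t; apply Subtype.ext; simp [θ]
  refine ⟨{ toFun := F0, map_add' := ?_, map_smul' := ?_ }, ?_, ?_⟩
  · intro x y
    induction x using LocalizedModule.induction_on with
    | _ w s =>
    induction y using LocalizedModule.induction_on with
    | _ w' s' =>
    rw [LocalizedModule.mk_add_mk, hF0, hF0, hF0, LocalizedModule.mk_add_mk, map_add, hfS, hfS, hθ]
  · intro a x
    induction x using LocalizedModule.induction_on with
    | _ w s =>
    rw [LocalizedModule.smul'_mk, hF0, hF0, RingHom.id_apply, LocalizedModule.smul'_mk, map_smul]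
  · intro w
    change F0 (LocalizedModule.mkLinearMap S W w) = _
    rw [LocalizedModule.mkLinearMap_apply, hF0, LocalizedModule.mkLinearMap_apply]
    congr 1
    apply Subtype.ext; simp [θ]
  · intro Q x
    change F0 (Q • x) = sc c Q • F0 x
    induction x using LocalizedModule.induction_on with
    | _ w s =>
    rw [LocalizedModule.smul'_mk, hF0, hF0, LocalizedModule.smul'_mk, hf]


/-! ### Part A2 -/

open Polynomial in
lemma aeval_mul_of {P : Type} [Ring P] [Algebra ℂ P] {R v : P} {c : ℂ}
    (h : R * v = c • (v * R)) (Q : ℂ[X]) : aeval R Q * v = v * aeval R (sc c Q) := by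
  have hpow : ∀ n : ℕ, R ^ n * v = c ^ n • (v * R ^ n) := by
    intro n
    induction n with
    | zero => simp
    | succ n ih =>
      rw [pow_succ, mul_assoc, h, mul_smul_comm, ← mul_assoc, ih, smul_mul_assoc, smul_smul,
        mul_assoc, ← pow_succ, ← pow_succ']
  induction Q using Polynomial.induction_on' with
  | add p q hp hq => simp only [map_add, add_mul, mul_add, hp, hq]
  | monomial n a =>
    rw [← C_mul_X_pow_eq_monomial]
    simp only [sc, map_mul, map_pow, aeval_C, aeval_X, Polynomial.algebraMap_eq]
    rw [mul_assoc, hpow, ← Algebra.smul_def, ← Algebra.smul_def,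
      ← Algebra.smul_def, _root_.smul_pow, mul_smul_comm, mul_smul_comm]

open Polynomial in
/-- Bimodule data with a canonical map and a chart trivialising it. -/
structure Chart (P W Hc : Type) [Ring P] [Algebra ℂ P] [AddCommGroup W] [Module ℂ W]
    [Module ℂ[X] W] [Ring Hc] [Algebra ℂ Hc] where
  lm : P →ₐ[ℂ] Module.End ℂ W
  rm : P →ₗ[ℂ] Module.End ℂ W
  rm_one : rm 1 = 1
  rm_mul : ∀ a b w, rm (a * b) w = rm b (rm a w)
  lr : ∀ a b w, lm a (rm b w) = rm b (lm a w)
  e : W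
  D : P →ₗ[ℂ] P ⊗[ℂ] Hc
  D_one : D 1 = 1 ⊗ₜ 1
  coinv : ∀ b, D b = b ⊗ₜ 1 → lm b e = rm b e
  chi : W →ₗ[ℂ] P ⊗[ℂ] Hc
  chi_eq : ∀ p' p, chi (lm p' (rm p e)) =
    TensorProduct.map (LinearMap.mulLeft ℂ p') LinearMap.id (D p)
  span : ∀ w : W, w ∈ Submodule.span ℂ (Set.range fun x : P × P => lm x.1 (rm x.2 e))
  R : P
  X_smul : ∀ w : W, (X : ℂ[X]) • w = rm R w
  v : Fin 2 → Fin 2 → P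
  vs : Fin 2 → Fin 2 → P
  o : Fin 2 → Fin 2 → P
  gen : ∀ M : Submodule ℂ P, 1 ∈ M → (∀ p ∈ M, ∀ k a, p * v k a ∈ M) →
    (∀ p ∈ M, ∀ k a, p * o k a ∈ M) → ∀ p, p ∈ M
  h : Fin 2 → Fin 2 → Hc
  hgen : ∀ M : Submodule ℂ Hc, 1 ∈ M → (∀ x ∈ M, ∀ a b, x * h a b ∈ M) → ∀ x, x ∈ M
  eps : Fin 2 → Fin 2 → ℂ
  lift : ∀ (E : Type) [Ring E] [Algebra ℂ E] (m : Fin 2 → Fin 2 → E),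
    (∀ i j, ∑ a, ∑ b, eps a b • (m i a * m j b) = eps i j • 1) →
    (∀ a b, ∑ i, ∑ j, eps i j • (m i a * m j b) = eps a b • 1) →
    ∃ Φ : Hc →ₐ[ℂ] E, ∀ a b, Φ (h a b) = m a b
  c : Fin 2 → ℂ
  cc : c 0 * c 1 = 1
  d : Fin 2 → ℂ
  d_ne : ∀ k, d k ≠ 0
  g : ℂ[X]
  S : Submonoid ℂ[X]
  g_mem : g ∈ S
  S_sc : ∀ s ∈ S, ∀ c : ℂ, c ≠ 0 → sc c s ∈ S
  lam : Fin 2 → ℂ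
  mu : Fin 2 → ℂ
  kap : Fin 2 → Fin 2 → ℂ
  t : Fin 2 → ℂ
  Dv : ∀ p k a, D (p * v k a) = ∑ b, TensorProduct.map (LinearMap.mulRight ℂ (v k b))
    (LinearMap.mulRight ℂ (h b a)) (D p)
  Do : ∀ p k a, D (p * o k a) = ∑ b, TensorProduct.map (LinearMap.mulRight ℂ (o k b))
    (LinearMap.mulLeft ℂ (h b a)) (D p)
  Rv : ∀ k a, R * v k a = c (k + 1) • (v k a * R)
  Rvs : ∀ k a, R * vs k a = c k • (vs k a * R)
  Ro : ∀ k a, R * o k a = d k • (o k a * R)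
  vs_v : ∀ a b, ∑ k, vs k a * v k b = if a = b then aeval R g else 0
  v_vs : ∀ k l, ∑ a, v k a * vs l a = if k = l then aeval R (sc (c k) g) else 0
  rowv : ∀ k l, ∑ a, ∑ b, eps a b • (v k a * v l b) =
    if k = l then 0 else lam k • aeval R (sc (c k) g)
  rowvs : ∀ i j, lam 0 • (vs 1 j * vs 0 i) + lam 1 • (vs 0 j * vs 1 i) = eps i j • aeval R g
  colvs : ∀ k l, ∑ i, ∑ j, eps i j • (vs l j * vs k i) =
    if k = l then 0 else mu k • aeval R (sc (c k) g)
  colv : ∀ a b, mu 0 • (v 0 a * v 1 b) + mu 1 • (v 1 a * v 0 b) = eps a b • aeval R g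
  o_vs : ∀ k l a b, o k a * vs l b = kap k l • (vs l b * o k a)
  o_v : ∀ k l a b, kap k l • (o k a * v l b) = t k • (v l b * o k a)
  t_g : ∀ k, t k • sc (d k) g = g
  b_coinv : ∀ k l, D (∑ b, o k b * vs l b) = (∑ b, o k b * vs l b) ⊗ₜ 1

namespace Chart
set_option linter.unusedSectionVars false
open Polynomial
variable {P W Hc : Type} [Ring P] [Algebra ℂ P] [AddCommGroup W] [Module ℂ W]
    [Module ℂ[X] W] [IsScalarTower ℂ ℂ[X] W] [Ring Hc] [Algebra ℂ Hc] (Y : Chart P W Hc)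

lemma smul_eq (Q : ℂ[X]) (w : W) : Q • w = Y.rm (aeval Y.R Q) w := by
  induction Q using Polynomial.induction_on' generalizing w with
  | add p q hp hq => simp only [map_add, add_smul, hp, hq, LinearMap.add_apply]
  | monomial n a =>
    rw [← C_mul_X_pow_eq_monomial, ← smul_eq_C_mul, smul_assoc, map_smul, map_smul,
      LinearMap.smul_apply]
    congr 1
    induction n with
    | zero => simp [Y.rm_one]
    | succ n ih => 
      rw [pow_succ', mul_smul, ih, Y.X_smul, mul_comm, map_mul, Y.rm_mul, aeval_X]

lemma rm_smul {v : P} {c : ℂ} (h : Y.R * v = c • (v * Y.R)) (Q : ℂ[X]) (w : W) :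
    Y.rm v (Q • w) = sc c Q • Y.rm v w := by
  rw [Y.smul_eq, Y.smul_eq, ← Y.rm_mul, ← Y.rm_mul, aeval_mul_of h]

lemma lm_smul (p : P) (Q : ℂ[X]) (w : W) :
    Y.lm p (Q • w) = Q • Y.lm p w := by
  rw [Y.smul_eq, Y.smul_eq, Y.lr]

lemma c_ne (k : Fin 2) : Y.c k ≠ 0 := by
  have := Y.cc
  fin_cases k
  · exact left_ne_zero_of_mul_eq_one this
  · exact right_ne_zero_of_mul_eq_one this

lemma c_cc (k : Fin 2) : Y.c k * Y.c (k+1) = 1 := by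
  have := Y.cc
  fin_cases k
  · simpa using this
  · simpa [mul_comm] using this

/-- Range of `chi` is stable under left multiplication. -/
lemma range_left {y : P ⊗[ℂ] Hc} (hy : y ∈ LinearMap.range Y.chi) (p : P) :
    TensorProduct.map (LinearMap.mulLeft ℂ p) LinearMap.id y ∈ LinearMap.range Y.chi := by
  obtain ⟨w, rfl⟩ := hy
  refine ⟨Y.lm p w, ?_⟩
  have := Y.span w
  induction this using Submodule.span_induction with
  | mem x hx =>
    obtain ⟨⟨a, b⟩, rfl⟩ := hx
    simp only
    rw [← Module.End.mul_apply, ← map_mul, Y.chi_eq, Y.chi_eq]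
    generalize Y.D b = y
    induction y using TensorProduct.induction_on with
    | zero => simp
    | tmul u v => simp [mul_assoc]
    | add u v hu hv => simp only [map_add, hu, hv]
  | zero => simp
  | add u v _ _ hu hv => simp only [map_add, hu, hv]
  | smul a u _ hu => simp only [map_smul, hu]

/-- Equivariance of `chi` under right multiplication by chart doublets. -/
lemma chi_rm (k a : Fin 2) (w : W) :
    Y.chi (Y.rm (Y.v k a) w) = ∑ b, TensorProduct.map (LinearMap.mulRight ℂ (Y.v k b))
    (LinearMap.mulRight ℂ (Y.h b a)) (Y.chi w) := by
  have := Y.span w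
  induction this using Submodule.span_induction with
  | mem x hx =>
    obtain ⟨⟨p', p⟩, rfl⟩ := hx
    simp only
    rw [← Y.lr, ← Y.rm_mul, Y.chi_eq, Y.chi_eq, Y.Dv, map_sum]
    refine Finset.sum_congr rfl fun b _ => ?_
    generalize Y.D p = y
    induction y using TensorProduct.induction_on with
    | zero => simp
    | tmul u v => simp [mul_assoc]
    | add u v hu hv => simp only [map_add, hu, hv]
  | zero => simp
  | add u v _ _ hu hv => simp only [map_add, hu, hv, Finset.sum_add_distrib]
  | smul a u _ hu => simp only [map_smul, hu, Finset.smul_sum]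

lemma S_c {s : ℂ[X]} (hs : s ∈ Y.S) (k : Fin 2) : sc (Y.c k) s ∈ Y.S := Y.S_sc s hs _ (Y.c_ne k)

theorem surj (x : Hc) : ∃ Q ∈ Y.S, ∀ p : P, (p * aeval Y.R Q) ⊗ₜ[ℂ] x ∈ LinearMap.range Y.chi := by
  let M : Submodule ℂ Hc :=
    { carrier := {x | ∃ Q ∈ Y.S, ∀ p : P, (p * aeval Y.R Q) ⊗ₜ[ℂ] x ∈ LinearMap.range Y.chi}
      zero_mem' := ⟨1, one_mem _, fun p => by simp⟩
      add_mem' := by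
        rintro x y ⟨Q, hQ, h⟩ ⟨Q', hQ', h'⟩
        refine ⟨Q * Q', mul_mem hQ hQ', fun p => ?_⟩
        rw [TensorProduct.tmul_add]
        refine add_mem ?_ ?_
        · rw [mul_comm, map_mul, ← mul_assoc]; exact h _
        · rw [map_mul, ← mul_assoc]; exact h' _
      smul_mem' := by
        rintro a x ⟨Q, hQ, h⟩
        refine ⟨Q, hQ, fun p => ?_⟩
        rw [TensorProduct.tmul_smul]
        exact Submodule.smul_mem _ _ (h p) }
  refine Y.hgen M ?_ ?_ x
  · refine ⟨1, one_mem _, fun p => ⟨Y.lm p (Y.rm 1 Y.e), ?_⟩⟩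
    rw [Y.chi_eq, Y.D_one]; simp
  · rintro x ⟨Q, hQ, hx⟩ a b
    refine ⟨sc (Y.c 1) Q * sc (Y.c 0) Q * Y.g,
      mul_mem (mul_mem (Y.S_c hQ 1) (Y.S_c hQ 0)) Y.g_mem, fun p => ?_⟩
    set F := sc (Y.c 1) Q * sc (Y.c 0) Q with hF
    have h1 : ∀ k, (p * aeval Y.R F * Y.vs k a) ⊗ₜ[ℂ] x ∈ LinearMap.range Y.chi := by
      intro k
      obtain ⟨Q2, hQ2⟩ : ∃ Q2, sc (Y.c k) F = Q2 * Q := by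
        fin_cases k
        · refine ⟨sc (Y.c 0) (sc (Y.c 0) Q), ?_⟩
          simp only [hF, map_mul, sc_sc, Fin.zero_eta]
          rw [Y.cc, sc_one, mul_comm]
        · refine ⟨sc (Y.c 1) (sc (Y.c 1) Q), ?_⟩
          simp only [hF, map_mul, sc_sc, Fin.mk_one]
          rw [mul_comm (Y.c 1) (Y.c 0), Y.cc, sc_one]
      rw [mul_assoc, aeval_mul_of (Y.Rvs k a), hQ2, map_mul, ← mul_assoc, ← mul_assoc]
      exact hx _
    have h2 : ∀ k, (∑ c, TensorProduct.map (LinearMap.mulRight ℂ (Y.v k c))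
        (LinearMap.mulRight ℂ (Y.h c b)) ((p * aeval Y.R F * Y.vs k a) ⊗ₜ[ℂ] x))
        ∈ LinearMap.range Y.chi := by
      intro k
      obtain ⟨w, hw⟩ := h1 k
      rw [← hw]
      exact ⟨_, Y.chi_rm k b w⟩
    have h3 := Submodule.sum_mem (LinearMap.range Y.chi) (t := Finset.univ) fun k _ => h2 k
    rw [Finset.sum_comm] at h3
    simp only [TensorProduct.map_tmul, LinearMap.mulRight_apply, mul_assoc,
      ← TensorProduct.sum_tmul, ← Finset.mul_sum, Y.vs_v] at h3
    fin_cases a <;> simpa [Fin.sum_univ_two, map_mul, mul_assoc] using h3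

end Chart

/-! ### Part A3 -/

open Polynomial in
/-- Localized operators attached to a chart. -/
structure ChartLoc {P W Hc : Type} [Ring P] [Algebra ℂ P] [AddCommGroup W] [Module ℂ W]
    [Module ℂ[X] W] [Ring Hc] [Algebra ℂ Hc] (Y : Chart P W Hc) (V : Type) [AddCommGroup V]
    [Module ℂ V] [Module ℂ[X] V] where
  ι : W →ₗ[ℂ] V
  L : P →ₐ[ℂ] Module.End ℂ V
  r : Fin 2 → Fin 2 → Module.End ℂ V
  ro : Fin 2 → Fin 2 → Module.End ℂ V
  ι_X : ∀ (Q : ℂ[X]) w, ι (Q • w) = Q • ι w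
  L_X : ∀ p (Q : ℂ[X]) y, L p (Q • y) = Q • L p y
  r_X : ∀ k a (Q : ℂ[X]) y, r k a (Q • y) = sc (Y.c (k + 1)) Q • r k a y
  ro_X : ∀ k a (Q : ℂ[X]) y, ro k a (Q • y) = sc (Y.d k) Q • ro k a y
  L_r : ∀ p k a y, L p (r k a y) = r k a (L p y)
  L_ro : ∀ p k a y, L p (ro k a y) = ro k a (L p y)
  L_ι : ∀ p w, L p (ι w) = ι (Y.lm p w)
  r_ι : ∀ k a w, r k a (ι w) = ι (Y.rm (Y.v k a) w)
  ro_ι : ∀ k a w, ro k a (ι w) = ι (Y.rm (Y.o k a) w)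
  rowr : ∀ k l y, ∑ a, ∑ b, Y.eps a b • r l b (r k a y) =
    if k = l then 0 else Y.lam k • sc (Y.c k) Y.g • y
  colr : ∀ a b y, Y.mu 0 • r 1 b (r 0 a y) + Y.mu 1 • r 0 b (r 1 a y) = Y.eps a b • Y.g • y
  ror : ∀ k l a b y, Y.kap k l • r l b (ro k a y) = Y.t k • ro k a (r l b y)
  inv : ∀ s ∈ Y.S, Function.Bijective fun y : V => s • y

namespace ChartLoc
set_option linter.unusedSectionVars false
open Polynomial
variable {P W Hc : Type} [Ring P] [Algebra ℂ P] [AddCommGroup W] [Module ℂ W]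
    [Module ℂ[X] W] [IsScalarTower ℂ ℂ[X] W] [Ring Hc] [Algebra ℂ Hc] {Y : Chart P W Hc}
    {V : Type} [AddCommGroup V] [Module ℂ V] [Module ℂ[X] V] [IsScalarTower ℂ ℂ[X] V]
    (N : ChartLoc Y V)

/-- Inverse of the action of an element of `S`. -/
def G (s : Y.S) : Module.End ℂ V :=
  (LinearEquiv.ofBijective (Algebra.lsmul ℂ ℂ V (s : ℂ[X])) (N.inv s s.2)).symm.toLinearMap

lemma smul_G (s : Y.S) (y : V) : (s : ℂ[X]) • N.G s y = y :=
  (LinearEquiv.ofBijective (Algebra.lsmul ℂ ℂ V (s : ℂ[X])) (N.inv s s.2)).apply_symm_apply y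

lemma G_smul (s : Y.S) (y : V) : N.G s ((s : ℂ[X]) • y) = y :=
  (LinearEquiv.ofBijective (Algebra.lsmul ℂ ℂ V (s : ℂ[X])) (N.inv s s.2)).symm_apply_apply y

lemma G_eq (s : Y.S) {x y : V} (h : y = (s : ℂ[X]) • x) : N.G s y = x := by
  rw [h, N.G_smul]

lemma G_X (s : Y.S) (Q : ℂ[X]) (y : V) : N.G s (Q • y) = Q • N.G s y := by
  apply N.G_eq
  rw [smul_comm, N.smul_G]

lemma L_G (p : P) (s : Y.S) (y : V) : N.L p (N.G s y) = N.G s (N.L p y) := by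
  symm; apply N.G_eq
  rw [← N.L_X, N.smul_G]

/-- scaled elements of S -/
def scS (s : Y.S) (c : ℂ) (hc : c ≠ 0) : Y.S := ⟨sc c s, Y.S_sc s s.2 c hc⟩

lemma r_G (k a) (s : Y.S) (y : V) :
    N.r k a (N.G s y) = N.G (scS s (Y.c (k+1)) (Y.c_ne _)) (N.r k a y) := by
  symm; apply N.G_eq
  rw [scS, ← N.r_X, N.smul_G]

lemma ro_G (k a) (s : Y.S) (y : V) :
    N.ro k a (N.G s y) = N.G (scS s (Y.d k) (Y.d_ne _)) (N.ro k a y) := by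
  symm; apply N.G_eq
  rw [scS, ← N.ro_X, N.smul_G]

/-- The central element `g`. -/
def gS (Y : Chart P W Hc) : Y.S := ⟨Y.g, Y.g_mem⟩

/-- The matrix of operators representing `h`. -/
def Op (i a : Fin 2) : Module.End ℂ V := N.G (gS Y) ∘ₗ ∑ k, N.L (Y.vs k i) ∘ₗ N.r k a

lemma Op_apply (i a : Fin 2) (y : V) :
    N.Op i a y = N.G (gS Y) (∑ k, N.L (Y.vs k i) (N.r k a y)) := by
  simp [Op]

lemma L_Op_comm_G (p : P) (i a : Fin 2) (y : V) :
    N.L p (N.Op i a y) = N.G (gS Y) (∑ k, N.L (p * Y.vs k i) (N.r k a y)) := by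
  rw [Op_apply, L_G, map_sum]
  simp only [map_mul, Module.End.mul_apply]

lemma Op_Op (j b i a : Fin 2) (y : V) : N.Op j b (N.Op i a y) =
    ∑ l, ∑ k, N.G (gS Y) (N.G (scS (gS Y) (Y.c (l+1)) (Y.c_ne _))
      (N.L (Y.vs l j * Y.vs k i) (N.r l b (N.r k a y)))) := by
  rw [Op_apply, map_sum]
  refine Finset.sum_congr rfl fun l _ => ?_
  rw [Op_apply, r_G, L_G, map_sum, map_sum, map_sum, map_sum]
  refine Finset.sum_congr rfl fun k _ => ?_
  rw [map_mul, Module.End.mul_apply, ← N.L_r (Y.vs k i) l b]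

/-- The subspace on which left and right multiplication by `R` agree. -/
def Z : Submodule ℂ V where
  carrier := {y | N.L Y.R y = (X : ℂ[X]) • y}
  zero_mem' := by simp
  add_mem' := by
    intro a b ha hb
    simp only [Set.mem_ofPred_eq] at *
    rw [map_add, ha, hb, smul_add]
  smul_mem' := by
    intro c y hy
    simp only [Set.mem_ofPred_eq] at *
    rw [map_smul, hy, smul_comm]

lemma mem_Z {y : V} : y ∈ N.Z ↔ N.L Y.R y = (X : ℂ[X]) • y := Iff.rfl

lemma L_aeval {y : V} (hy : y ∈ N.Z) (Q : ℂ[X]) : N.L (aeval Y.R Q) y = Q • y := by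
  induction Q using Polynomial.induction_on' with
  | add p q hp hq => simp only [map_add, add_smul, hp, hq, LinearMap.add_apply]
  | monomial n a =>
    rw [← C_mul_X_pow_eq_monomial, ← smul_eq_C_mul, smul_assoc, map_smul, map_smul,
      LinearMap.smul_apply]
    congr 1
    induction n with
    | zero => simp
    | succ n ih =>
      rw [pow_succ', mul_smul, mul_comm, map_mul, map_mul, Module.End.mul_apply, aeval_X, hy,
        N.L_X, ih]

lemma sc_X (c : ℂ) : sc c X = c • X := by
  simp [sc, smul_eq_C_mul]

lemma rr_mem_Z {y : V} (hy : y ∈ N.Z) (k l a b : Fin 2) (hkl : l = k + 1) :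
    N.r l b (N.r k a y) ∈ N.Z := by
  rw [mem_Z, N.L_r, N.L_r, N.mem_Z.1 hy, N.r_X, N.r_X, sc_sc, hkl, mul_comm, Y.c_cc, sc_one]

lemma Op_mem_Z {y : V} (hy : y ∈ N.Z) (i a : Fin 2) : N.Op i a y ∈ N.Z := by
  rw [mem_Z, L_Op_comm_G, Op_apply, ← N.G_X, Finset.smul_sum]
  congr 1
  refine Finset.sum_congr rfl fun k _ => ?_
  rw [Y.Rvs, map_smul, map_mul, LinearMap.smul_apply, Module.End.mul_apply, N.L_r,
    N.mem_Z.1 hy, N.r_X, N.L_X, sc_X, smul_assoc, smul_smul, Y.c_cc, one_smul]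

lemma ι_mem_Z : N.ι Y.e ∈ N.Z ↔ N.ι (Y.lm Y.R Y.e) = N.ι (Y.rm Y.R Y.e) := by
  rw [mem_Z, N.L_ι, ← N.ι_X, Y.X_smul]

lemma G_cancel (s : Y.S) (Q : ℂ[X]) (h : Q = s) (y : V) : N.G s (Q • y) = y := by
  rw [h, N.G_smul]

lemma Op_row {y : V} (hy : y ∈ N.Z) (i j : Fin 2) :
    ∑ a, ∑ b, Y.eps a b • N.Op j b (N.Op i a y) = Y.eps i j • y := by
  have h1 : ∑ a, ∑ b, Y.eps a b • N.Op j b (N.Op i a y) =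
      ∑ l, ∑ k, N.G (gS Y) (N.G (scS (gS Y) (Y.c (l+1)) (Y.c_ne _))
      (N.L (Y.vs l j * Y.vs k i) (∑ a, ∑ b, Y.eps a b • N.r l b (N.r k a y)))) := by
    simp only [Op_Op, map_sum, map_smul, Finset.smul_sum]
    simp only [Fin.sum_univ_two]
    abel
  rw [h1]
  simp only [N.rowr]
  have h2 : ∀ k l, l = k + 1 → N.G (gS Y) (N.G (scS (gS Y) (Y.c (l+1)) (Y.c_ne _))
      (N.L (Y.vs l j * Y.vs k i) (Y.lam k • sc (Y.c k) Y.g • y))) =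
      N.G (gS Y) (N.L (Y.lam k • (Y.vs l j * Y.vs k i)) y) := by
    rintro k l rfl
    have : k + 1 + 1 = k := by fin_cases k <;> rfl
    rw [map_smul, N.L_X, map_smul, N.G_cancel, map_smul N.L, LinearMap.smul_apply]
    simp [scS, gS, this]
  simp only [Fin.sum_univ_two, Fin.isValue, if_true, map_zero, zero_ne_one, one_ne_zero, if_false,
    zero_add, add_zero]
  have h21 := h2 1 0 rfl
  simp only [zero_add, Fin.isValue] at h21
  rw [h2 0 1 rfl, h21, add_comm, ← map_add, ← LinearMap.add_apply, ← map_add]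
  rw [Y.rowvs, map_smul, LinearMap.smul_apply, N.L_aeval hy, map_smul, N.G_cancel]
  rfl

lemma Op_col {y : V} (hy : y ∈ N.Z) (a b : Fin 2) :
    ∑ i, ∑ j, Y.eps i j • N.Op j b (N.Op i a y) = Y.eps a b • y := by
  have h1 : ∑ i, ∑ j, Y.eps i j • N.Op j b (N.Op i a y) =
      ∑ l, ∑ k, N.G (gS Y) (N.G (scS (gS Y) (Y.c (l+1)) (Y.c_ne _))
      (N.L (∑ i, ∑ j, Y.eps i j • (Y.vs l j * Y.vs k i)) (N.r l b (N.r k a y)))) := by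
    simp only [Op_Op, map_sum, map_smul, Finset.smul_sum, LinearMap.sum_apply, LinearMap.smul_apply]
    simp only [Fin.sum_univ_two]
    abel
  rw [h1]
  simp only [Y.colvs]
  have h2 : ∀ k l, l = k + 1 → N.G (gS Y) (N.G (scS (gS Y) (Y.c (l+1)) (Y.c_ne _))
      (N.L (Y.mu k • aeval Y.R (sc (Y.c k) Y.g)) (N.r l b (N.r k a y)))) =
      N.G (gS Y) (Y.mu k • (N.r l b (N.r k a y))) := by
    intro k l hl
    have : l + 1 = k := by subst hl; fin_cases k <;> rfl
    rw [map_smul N.L, LinearMap.smul_apply, N.L_aeval (N.rr_mem_Z hy _ _ _ _ hl), map_smul,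
      N.G_cancel]
    simp [scS, gS, this]
  simp only [Fin.sum_univ_two, Fin.isValue, if_true, map_zero, zero_ne_one, one_ne_zero, if_false,
    zero_add, add_zero, LinearMap.zero_apply]
  have h21 := h2 1 0 rfl
  simp only [zero_add, Fin.isValue] at h21
  rw [h2 0 1 rfl, h21, add_comm, ← map_add, N.colr, map_smul, N.G_cancel]
  rfl

end ChartLoc

/-! ### Part A4 -/

namespace ChartLoc
set_option linter.unusedSectionVars false
open Polynomial
variable {P W Hc : Type} [Ring P] [Algebra ℂ P] [AddCommGroup W] [Module ℂ W]
    [Module ℂ[X] W] [IsScalarTower ℂ ℂ[X] W] [Ring Hc] [Algebra ℂ Hc] {Y : Chart P W Hc}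
    {V : Type} [AddCommGroup V] [Module ℂ V] [Module ℂ[X] V] [IsScalarTower ℂ ℂ[X] V]
    (N : ChartLoc Y V)

/-- Restriction of `Op` to `Z`. -/
def OpZ (i a : Fin 2) : Module.End ℂ N.Z := (N.Op i a).restrict fun _ hy => N.Op_mem_Z hy i a

lemma OpZ_coe (i a : Fin 2) (y : N.Z) : (N.OpZ i a y : V) = N.Op i a y := rfl

lemma exists_Lambda : ∃ Φ : Hc →ₐ[ℂ] (Module.End ℂ N.Z)ᵐᵒᵖ,
    ∀ a b, Φ (Y.h a b) = MulOpposite.op (N.OpZ a b) := by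
  apply Y.lift
  · intro i j
    apply MulOpposite.unop_injective
    refine LinearMap.ext fun y => Subtype.ext ?_
    have := N.Op_row y.2 i j
    simpa [OpZ_coe, ← MulOpposite.op_mul] using this
  · intro a b
    apply MulOpposite.unop_injective
    refine LinearMap.ext fun y => Subtype.ext ?_
    have := N.Op_col y.2 a b
    simpa [OpZ_coe, ← MulOpposite.op_mul] using this

/-- The representation of `Hc` on `Z`. -/
def Lam : Hc →ₐ[ℂ] (Module.End ℂ N.Z)ᵐᵒᵖ := N.exists_Lambda.choose

lemma Lam_h (a b) : N.Lam (Y.h a b) = MulOpposite.op (N.OpZ a b) := N.exists_Lambda.choose_spec a b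

/-- The action of `Hc` on `Z`, valued in `V`. -/
def act : Hc →ₗ[ℂ] N.Z →ₗ[ℂ] V where
  toFun x := N.Z.subtype ∘ₗ (N.Lam x).unop
  map_add' x y := by ext; simp
  map_smul' a x := by ext; simp

lemma act_mem (x : Hc) (y : N.Z) : N.act x y ∈ N.Z := ((N.Lam x).unop y).2

lemma act_one (y : N.Z) : N.act 1 y = y := by simp [act]

lemma act_mul_h (x : Hc) (a b) (y : N.Z) : N.act (x * Y.h a b) y = N.Op a b (N.act x y) := by
  simp [act, Lam_h, OpZ_coe]

lemma act_h_mul (x : Hc) (a b) (y : N.Z) : N.act (Y.h a b * x) y = N.act x (N.OpZ a b y) := by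
  simp [act, Lam_h]

/-- The base point. -/
def e0 (hR : Y.lm Y.R Y.e = Y.rm Y.R Y.e) : N.Z := ⟨N.ι Y.e, N.ι_mem_Z.2 (congrArg _ hR)⟩

variable (hR : Y.lm Y.R Y.e = Y.rm Y.R Y.e)

/-- The candidate inverse of `chi`. -/
def sig : P ⊗[ℂ] Hc →ₗ[ℂ] V :=
  TensorProduct.lift ((LinearMap.llcomp ℂ Hc V V).flip (N.act.flip (N.e0 hR)) ∘ₗ N.L.toLinearMap)

lemma sig_tmul (p : P) (x : Hc) : N.sig hR (p ⊗ₜ x) = N.L p (N.act x (N.e0 hR)) := by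
  simp [sig]

lemma sig_v (k a : Fin 2) (y : P ⊗[ℂ] Hc) :
    N.sig hR (∑ b, TensorProduct.map (LinearMap.mulRight ℂ (Y.v k b))
      (LinearMap.mulRight ℂ (Y.h b a)) y) = N.r k a (N.sig hR y) := by
  induction y using TensorProduct.induction_on with
  | zero => simp
  | add u v hu hv => simp only [map_add, Finset.sum_add_distrib, hu, hv]
  | tmul p x =>
    simp only [TensorProduct.map_tmul, LinearMap.mulRight_apply, map_sum, sig_tmul, map_mul,
      Module.End.mul_apply, act_mul_h]
    rw [← map_sum, ← N.L_r]
    congr 1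
    simp only [L_Op_comm_G, ← map_sum]
    have hmem := N.act_mem x (N.e0 hR)
    generalize N.act x (N.e0 hR) = y at hmem
    apply N.G_eq
    rw [Finset.sum_comm]
    have : ∀ l, ∑ b, N.L (Y.v k b * Y.vs l b) (N.r l a y) =
        if k = l then N.r l a (sc (Y.c k) Y.g • y) else 0 := by
      intro l
      rw [← LinearMap.sum_apply, ← map_sum, Y.v_vs]
      split_ifs with h
      · rw [N.L_r, N.L_aeval hmem]
      · simp
    simp only [this, Finset.sum_ite_eq, Finset.mem_univ, if_true]
    rw [N.r_X, sc_sc, mul_comm, Y.c_cc, sc_one]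
    rfl

lemma o_base (k a : Fin 2) :
    ∑ b, N.L (Y.o k b) (N.OpZ b a (N.e0 hR)) = N.ro k a (N.e0 hR) := by
  simp only [OpZ_coe, L_Op_comm_G, ← map_sum]
  apply N.G_eq
  rw [Finset.sum_comm]
  have : ∀ l, ∑ b, N.L (Y.o k b * Y.vs l b) (N.r l a (N.e0 hR)) =
      N.ι (Y.rm ((∑ b, Y.o k b * Y.vs l b) * Y.v l a) Y.e) := by
    intro l
    rw [← LinearMap.sum_apply, ← map_sum, N.L_r]
    change N.r l a (N.L _ (N.ι Y.e)) = _
    rw [N.L_ι, Y.coinv _ (Y.b_coinv k l), N.r_ι, Y.rm_mul]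
  simp only [this]
  have h2 : ∑ l, (∑ b, Y.o k b * Y.vs l b) * Y.v l a = Y.o k a * aeval Y.R Y.g := by
    simp only [Finset.sum_mul, mul_assoc]
    rw [Finset.sum_comm]
    simp only [← Finset.mul_sum, Y.vs_v]
    simp
  rw [← map_sum, ← LinearMap.sum_apply, ← map_sum, h2, Y.rm_mul, ← Y.smul_eq, N.ι_X, ← N.ro_ι]
  rfl

lemma o_step (k a : Fin 2) (x : Hc) :
    ∑ b, N.L (Y.o k b) (N.act x (N.OpZ b a (N.e0 hR))) = N.ro k a (N.act x (N.e0 hR)) := by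
  let M : Submodule ℂ Hc := LinearMap.ker
    (∑ b, N.L (Y.o k b) ∘ₗ N.act.flip (N.OpZ b a (N.e0 hR)) - N.ro k a ∘ₗ N.act.flip (N.e0 hR))
  have hM : ∀ x, x ∈ M ↔ ∑ b, N.L (Y.o k b) (N.act x (N.OpZ b a (N.e0 hR))) =
      N.ro k a (N.act x (N.e0 hR)) := by
    intro x
    simp [M, sub_eq_zero]
  rw [← hM]
  refine Y.hgen M ?_ ?_ x
  · rw [hM]
    simp only [act_one]
    exact N.o_base hR k a
  · intro x hx i j
    rw [hM] at hx ⊢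
    simp only [act_mul_h, L_Op_comm_G, Y.o_vs, ← map_sum]
    apply N.G_eq
    rw [Finset.sum_comm]
    have : ∀ l, ∑ b, N.L (Y.kap k l • (Y.vs l i * Y.o k b))
        (N.r l j (N.act x (N.OpZ b a (N.e0 hR)))) =
        Y.t k • N.ro k a (N.L (Y.vs l i) (N.r l j (N.act x (N.e0 hR)))) := by
      intro l
      simp only [map_smul, map_mul, LinearMap.smul_apply, Module.End.mul_apply]
      simp only [N.L_r (Y.o k _)]
      rw [← Finset.smul_sum, ← map_sum, ← map_sum, hx, ← map_smul, N.ror, map_smul, N.L_ro]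
    simp only [this]
    rw [← Finset.smul_sum, ← map_sum, Op_apply, ro_G]
    have h3 : (gS Y : ℂ[X]) = Y.t k • sc (Y.d k) Y.g := (Y.t_g k).symm
    rw [h3, smul_assoc]
    congr 1
    exact (N.smul_G (scS (gS Y) (Y.d k) (Y.d_ne _)) _).symm

lemma sig_o (k a : Fin 2) (y : P ⊗[ℂ] Hc) :
    N.sig hR (∑ b, TensorProduct.map (LinearMap.mulRight ℂ (Y.o k b))
      (LinearMap.mulLeft ℂ (Y.h b a)) y) = N.ro k a (N.sig hR y) := by
  induction y using TensorProduct.induction_on with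
  | zero => simp
  | add u v hu hv => simp only [map_add, Finset.sum_add_distrib, hu, hv]
  | tmul p x =>
    simp only [TensorProduct.map_tmul, LinearMap.mulRight_apply, LinearMap.mulLeft_apply,
      map_sum, sig_tmul, map_mul, Module.End.mul_apply, act_h_mul]
    rw [← map_sum, N.o_step, ← N.L_ro]

lemma sig_D (p : P) : N.sig hR (Y.D p) = N.ι (Y.rm p Y.e) := by
  let M : Submodule ℂ P := LinearMap.ker
    (N.sig hR ∘ₗ Y.D - N.ι ∘ₗ (LinearMap.applyₗ Y.e) ∘ₗ Y.rm)
  have hM : ∀ p, p ∈ M ↔ N.sig hR (Y.D p) = N.ι (Y.rm p Y.e) := by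
    intro x
    simp [M, sub_eq_zero]
  rw [← hM]
  refine Y.gen M ?_ ?_ ?_ p
  · rw [hM, Y.D_one, Y.rm_one, sig_tmul, act_one]; simp [e0]
  · intro p hp k a
    rw [hM] at hp ⊢
    rw [Y.Dv, N.sig_v, hp, Y.rm_mul, N.r_ι]
  · intro p hp k a
    rw [hM] at hp ⊢
    rw [Y.Do, N.sig_o, hp, Y.rm_mul, N.ro_ι]

lemma sig_chi (w : W) : N.sig hR (Y.chi w) = N.ι w := by
  have := Y.span w
  induction this using Submodule.span_induction with
  | mem x hx =>
    obtain ⟨⟨p', p⟩, rfl⟩ := hx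
    simp only
    rw [Y.chi_eq, ← N.L_ι, ← N.sig_D hR]
    generalize Y.D p = y
    induction y using TensorProduct.induction_on with
    | zero => simp
    | tmul u v => simp [sig_tmul]
    | add u v hu hv => simp only [map_add, hu, hv]
  | zero => simp
  | add u v _ _ hu hv => simp only [map_add, hu, hv]
  | smul a u _ hu => simp only [map_smul, hu]

end ChartLoc

/-! ### Part A5 -/

namespace Chart
set_option linter.unusedSectionVars false
open Polynomial
variable {P W Hc : Type} [Ring P] [Algebra ℂ P] [AddCommGroup W] [Module ℂ W]
    [Module ℂ[X] W] [IsScalarTower ℂ ℂ[X] W] [Ring Hc] [Algebra ℂ Hc] (Y : Chart P W Hc)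

lemma loc_ext (c : ℂ) (hc : c ≠ 0) (F F' : Module.End ℂ (LocalizedModule Y.S W))
    (h : ∀ (Q : ℂ[X]) y, F (Q • y) = sc c Q • F y)
    (h' : ∀ (Q : ℂ[X]) y, F' (Q • y) = sc c Q • F' y)
    (hι : ∀ w, F (LocalizedModule.mkLinearMap Y.S W w) = F' (LocalizedModule.mkLinearMap Y.S W w))
    (y) : F y = F' y := by
  obtain ⟨⟨w, s⟩, hs⟩ := IsLocalizedModule.surj Y.S (LocalizedModule.mkLinearMap Y.S W) y
  apply IsLocalizedModule.smul_injective (S := Y.S) (LocalizedModule.mkLinearMap Y.S W)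
    ⟨sc c s, Y.S_sc s s.2 c hc⟩
  change sc c s • F y = sc c s • F' y
  rw [← h, ← h']
  have hs' : (s : ℂ[X]) • y = LocalizedModule.mkLinearMap Y.S W w := hs
  rw [hs', hι]

lemma exists_op (c : ℂ) (hc : c ≠ 0) (f : Module.End ℂ W)
    (hf : ∀ (Q : ℂ[X]) (w : W), f (Q • w) = sc c Q • f w) :
    ∃ F : Module.End ℂ (LocalizedModule Y.S W),
      (∀ w, F (LocalizedModule.mkLinearMap Y.S W w) = LocalizedModule.mkLinearMap Y.S W (f w)) ∧
      ∀ (Q : ℂ[X]) w, F (Q • w) = sc c Q • F w :=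
  exists_locMap Y.S c (fun s hs => Y.S_sc s hs c hc) f hf

theorem exists_chartLoc : ∃ N : ChartLoc Y (LocalizedModule Y.S W),
    ∀ w, N.ι w = LocalizedModule.mkLinearMap Y.S W w := by
  have hL := fun p : P => Y.exists_op 1 one_ne_zero (Y.lm p)
    (fun Q w => by rw [Y.lm_smul, sc_one])
  choose L hLι hLX using hL
  simp only [sc_one] at hLX
  have hr := fun k a => Y.exists_op (Y.c (k+1)) (Y.c_ne _) (Y.rm (Y.v k a)) (Y.rm_smul (Y.Rv k a))
  choose r hrι hrX using hr
  have hro := fun k a => Y.exists_op (Y.d k) (Y.d_ne _) (Y.rm (Y.o k a)) (Y.rm_smul (Y.Ro k a))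
  choose ro hroι hroX using hro
  set j := LocalizedModule.mkLinearMap Y.S W with hj
  have jsm : ∀ (a : ℂ) w, j (a • w) = a • j w := fun a w => LinearMap.map_smul_of_tower j a w
  have ext1 : ∀ (F F' : Module.End ℂ (LocalizedModule Y.S W))
    (_ : ∀ (Q : ℂ[X]) y, F (Q • y) = Q • F y)
    (_ : ∀ (Q : ℂ[X]) y, F' (Q • y) = Q • F' y)
    (_ : ∀ w, F (j w) = F' (j w)), F = F' := by
    intro F F' h h' hι
    refine LinearMap.ext fun y => Y.loc_ext 1 one_ne_zero F F' ?_ ?_ hι y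
    · simpa only [sc_one] using h
    · simpa only [sc_one] using h'
  let L' : P →ₗ[ℂ] Module.End ℂ (LocalizedModule Y.S W) :=
    { toFun := L
      map_add' := by
        intro p p'
        refine ext1 _ _ (hLX _) ?_ ?_
        · intro Q y; simp only [LinearMap.add_apply, hLX, smul_add]
        · intro w; simp only [LinearMap.add_apply, hLι, map_add]
      map_smul' := by
        intro a p
        refine ext1 _ _ (hLX _) ?_ ?_
        · intro Q y; simp only [LinearMap.smul_apply, hLX, RingHom.id_apply]
          rw [smul_comm]
        · intro w; simp only [LinearMap.smul_apply, hLι, map_smul, RingHom.id_apply, jsm] }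
  let L'' : P →ₐ[ℂ] Module.End ℂ (LocalizedModule Y.S W) := AlgHom.ofLinearMap L'
    (by
      refine ext1 _ _ (hLX _) ?_ ?_
      · intro Q y; simp
      · intro w; change L 1 (j w) = _; rw [hLι]; simp)
    (by
      intro p p'
      refine ext1 _ _ (hLX _) ?_ ?_
      · intro Q y
        change L p (L p' (Q • y)) = Q • L p (L p' y)
        rw [hLX, hLX]
      · intro w
        change L (p * p') (j w) = L p (L p' (j w))
        rw [hLι, hLι, hLι, map_mul, Module.End.mul_apply])
  have cinv : ∀ k, Y.c (k+1) * Y.c k = 1 := fun k => by rw [mul_comm, Y.c_cc]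
  refine ⟨⟨j.restrictScalars ℂ, L'', r, ro, ?_, hLX, hrX, hroX, ?_, ?_, hLι, hrι, hroι, ?_, ?_, ?_,
    ?_⟩, fun w => rfl⟩
  · intro Q w
    exact map_smul j Q w
  · intro p k a y
    refine Y.loc_ext (Y.c (k+1)) (Y.c_ne _) (L p * r k a) (r k a * L p) ?_ ?_ ?_ y
    · intro Q y; simp only [Module.End.mul_apply, hLX, hrX]
    · intro Q y; simp only [Module.End.mul_apply, hLX, hrX]
    · intro w; simp only [Module.End.mul_apply, ← hj, hLι, hrι, Y.lr]
  · intro p k a y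
    refine Y.loc_ext (Y.d k) (Y.d_ne _) (L p * ro k a) (ro k a * L p) ?_ ?_ ?_ y
    · intro Q y; simp only [Module.End.mul_apply, hLX, hroX]
    · intro Q y; simp only [Module.End.mul_apply, hLX, hroX]
    · intro w; simp only [Module.End.mul_apply, ← hj, hLι, hroι, Y.lr]
  · intro k l y
    have key := Y.loc_ext (Y.c (l+1) * Y.c (k+1)) (mul_ne_zero (Y.c_ne _) (Y.c_ne _))
      (∑ a, ∑ b, Y.eps a b • (r l b * r k a))
      (if k = l then 0 else Y.lam k • Algebra.lsmul ℂ ℂ _ (sc (Y.c k) Y.g)) ?_ ?_ ?_ y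
    · simp only [LinearMap.sum_apply, LinearMap.smul_apply, Module.End.mul_apply] at key
      rw [key]
      split_ifs <;> simp
    · intro Q y
      simp only [LinearMap.sum_apply, LinearMap.smul_apply, Module.End.mul_apply, hrX, sc_sc,
        Finset.smul_sum, smul_comm (_ : ℂ) (_ : ℂ[X]) (_ : LocalizedModule Y.S W)]
    · intro Q y
      split_ifs with h
      · simp
      · have hl : l = k + 1 := by revert h; revert k l; decide
        have : l + 1 = k := by subst hl; fin_cases k <;> rfl
        rw [this, Y.c_cc, sc_one]
        simp only [LinearMap.smul_apply, Algebra.lsmul_coe]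
        rw [smul_comm Q, smul_comm Q]
    · intro w
      simp only [LinearMap.sum_apply, LinearMap.smul_apply, Module.End.mul_apply, ← hj, hrι]
      have h1 : ∑ a, ∑ b, Y.eps a b • j (Y.rm (Y.v l b) (Y.rm (Y.v k a) w)) =
          j (Y.rm (∑ a, ∑ b, Y.eps a b • (Y.v k a * Y.v l b)) w) := by
        simp only [map_sum, map_smul, LinearMap.sum_apply, LinearMap.smul_apply, Y.rm_mul, jsm]
      rw [h1, Y.rowv]
      split_ifs
      · simp
      · simp only [map_smul, LinearMap.smul_apply, jsm, ← Y.smul_eq, Algebra.lsmul_coe]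
  · intro a b y
    have key := Y.loc_ext 1 one_ne_zero
      (Y.mu 0 • (r 1 b * r 0 a) + Y.mu 1 • (r 0 b * r 1 a))
      (Y.eps a b • Algebra.lsmul ℂ ℂ _ Y.g) ?_ ?_ ?_ y
    · exact key
    · intro Q y
      have e1 : Y.c (1+1) * Y.c (0+1) = 1 := Y.cc
      have e2 : Y.c (0+1) * Y.c (1+1) = 1 := by rw [mul_comm]; exact Y.cc
      simp only [LinearMap.add_apply, LinearMap.smul_apply, Module.End.mul_apply, hrX, sc_sc,
        smul_add, smul_comm (_ : ℂ) (_ : ℂ[X]) (_ : LocalizedModule Y.S W), e1, e2]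
    · intro Q y
      simp only [LinearMap.smul_apply, Algebra.lsmul_coe, sc_one]
      rw [smul_comm Q, smul_comm Q]
    · intro w
      simp only [LinearMap.add_apply, LinearMap.smul_apply, Module.End.mul_apply, ← hj, hrι,
        Algebra.lsmul_coe]
      have h1 := congrArg (fun p => j (Y.rm p w)) (Y.colv a b)
      simp only [map_add, map_smul, LinearMap.add_apply, LinearMap.smul_apply, Y.rm_mul, jsm,
        ← Y.smul_eq] at h1
      exact h1
  · intro k l a b y
    have key := Y.loc_ext (Y.c (l+1) * Y.d k) (mul_ne_zero (Y.c_ne _) (Y.d_ne _))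
      (Y.kap k l • (r l b * ro k a)) (Y.t k • (ro k a * r l b)) ?_ ?_ ?_ y
    · exact key
    · intro Q y
      simp only [LinearMap.smul_apply, Module.End.mul_apply, hrX, hroX, sc_sc,
        smul_comm (_ : ℂ) (_ : ℂ[X]) (_ : LocalizedModule Y.S W)]
    · intro Q y
      simp only [LinearMap.smul_apply, Module.End.mul_apply, hrX, hroX, sc_sc,
        smul_comm (_ : ℂ) (_ : ℂ[X]) (_ : LocalizedModule Y.S W)]
      rw [mul_comm]
    · intro w
      simp only [LinearMap.smul_apply, Module.End.mul_apply, ← hj, hrι, hroι]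
      have h1 := congrArg (fun p => j (Y.rm p w)) (Y.o_v k l a b)
      simpa only [map_smul, LinearMap.smul_apply, Y.rm_mul, jsm] using h1
  · intro s hs
    have := IsLocalizedModule.map_units (S := Y.S) j ⟨s, hs⟩
    rw [Module.End.isUnit_iff] at this
    exact this

/-- Injectivity up to the multiplicative set of the chart. -/
theorem inj (hR : Y.lm Y.R Y.e = Y.rm Y.R Y.e) (w : W) (hw : Y.chi w = 0) :
    ∃ Q ∈ Y.S, Q • w = 0 := by
  obtain ⟨N, hN⟩ := Y.exists_chartLoc
  have h1 := N.sig_chi hR w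
  rw [hw, map_zero, hN, eq_comm, IsLocalizedModule.eq_zero_iff Y.S] at h1
  obtain ⟨s, hs⟩ := h1
  exact ⟨s, s.2, hs⟩

end Chart

/-! ### Part B1 -/

lemma free_gen {ι : Type} (M : Submodule ℂ (FreeAlgebra ℂ ι)) (h1 : 1 ∈ M)
    (hm : ∀ x ∈ M, ∀ i, x * FreeAlgebra.ι ℂ i ∈ M) (x : FreeAlgebra ℂ ι) : x ∈ M := by
  have key : ∀ a y : FreeAlgebra ℂ ι, y ∈ M → y * a ∈ M := by
    intro a
    induction a using FreeAlgebra.induction with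
    | grade0 r => intro y hy; rw [← Algebra.commutes, ← Algebra.smul_def]; exact M.smul_mem _ hy
    | grade1 i => intro y hy; exact hm y hy i
    | mul a b ha hb => intro y hy; rw [← mul_assoc]; exact hb _ (ha _ hy)
    | add a b ha hb => intro y hy; rw [mul_add]; exact M.add_mem (ha _ hy) (hb _ hy)
  simpa using key x 1 h1

lemma quot_gen {ι : Type} (s : FreeAlgebra ℂ ι → FreeAlgebra ℂ ι → Prop)
    (M : Submodule ℂ (RingQuot s)) (h1 : 1 ∈ M)
    (hm : ∀ x ∈ M, ∀ i, x * RingQuot.mkAlgHom ℂ s (FreeAlgebra.ι ℂ i) ∈ M) (x : RingQuot s) :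
    x ∈ M := by
  obtain ⟨x, rfl⟩ := RingQuot.mkAlgHom_surjective ℂ s x
  have := free_gen (M.comap (RingQuot.mkAlgHom ℂ s).toLinearMap) (by simpa using h1)
    (by intro x hx i; simpa using hm _ hx i) x
  simpa using this

/-! ### The algebra `H = O(SL_q(2))` -/

/-- The quantum symplectic form. -/
def eps (q : ℝ) : Fin 2 → Fin 2 → ℂ := ![![0, 1], ![-(q : ℂ), 0]]

/-- Free generators of `O(SL_q(2))`. -/
def H0 (i j : Fin 2) : FreeAlgebra ℂ (Fin 2 × Fin 2) := FreeAlgebra.ι ℂ (i, j)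

/-- The relations of `O(SL_q(2))`. -/
inductive relH (q : ℝ) : FreeAlgebra ℂ (Fin 2 × Fin 2) → FreeAlgebra ℂ (Fin 2 × Fin 2) → Prop
  | row (i j : Fin 2) : relH q (∑ a, ∑ b, eps q a b • (H0 i a * H0 j b)) (eps q i j • 1)
  | col (a b : Fin 2) : relH q (∑ i, ∑ j, eps q i j • (H0 i a * H0 j b)) (eps q a b • 1)

/-- The algebra `O(SL_q(2))`. -/
abbrev HH (q : ℝ) : Type := RingQuot (relH q)

/-- Generators of `O(SL_q(2))`. -/
def hh (q : ℝ) (i j : Fin 2) : HH q := RingQuot.mkAlgHom ℂ (relH q) (H0 i j)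

lemma hh_row (q : ℝ) (i j : Fin 2) :
    ∑ a, ∑ b, eps q a b • (hh q i a * hh q j b) = eps q i j • 1 := by
  have := RingQuot.mkAlgHom_rel ℂ (relH.row (q := q) i j)
  simp only [map_sum, map_smul, map_mul, map_one] at this
  exact this

lemma hh_col (q : ℝ) (a b : Fin 2) :
    ∑ i, ∑ j, eps q i j • (hh q i a * hh q j b) = eps q a b • 1 := by
  have := RingQuot.mkAlgHom_rel ℂ (relH.col (q := q) a b)
  simp only [map_sum, map_smul, map_mul, map_one] at this
  exact this

lemma hh_gen (q : ℝ) (M : Submodule ℂ (HH q)) (h1 : 1 ∈ M)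
    (hm : ∀ x ∈ M, ∀ a b, x * hh q a b ∈ M) (x : HH q) : x ∈ M :=
  quot_gen _ M h1 (fun x hx i => hm x hx i.1 i.2) x

lemma hh_lift (q : ℝ) (E : Type) [Ring E] [Algebra ℂ E] (m : Fin 2 → Fin 2 → E)
    (hr : ∀ i j, ∑ a, ∑ b, eps q a b • (m i a * m j b) = eps q i j • 1)
    (hc : ∀ a b, ∑ i, ∑ j, eps q i j • (m i a * m j b) = eps q a b • 1) :
    ∃ Φ : HH q →ₐ[ℂ] E, ∀ a b, Φ (hh q a b) = m a b := by
  let φ : FreeAlgebra ℂ (Fin 2 × Fin 2) →ₐ[ℂ] E := FreeAlgebra.lift ℂ fun p => m p.1 p.2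
  have hφ : ∀ a b, φ (H0 a b) = m a b := fun a b => by simp [φ, H0]
  refine ⟨RingQuot.liftAlgHom ℂ ⟨φ, ?_⟩, ?_⟩
  · intro x y h
    induction h with
    | row i j => simpa only [map_sum, map_smul, map_mul, map_one, hφ] using hr i j
    | col a b => simpa only [map_sum, map_smul, map_mul, map_one, hφ] using hc a b
  · intro a b
    rw [hh, RingQuot.liftAlgHom_mkAlgHom_apply, hφ]

section
variable (q : ℝ)

lemma ab : hh q 0 0 * hh q 0 1 = (q : ℂ) • (hh q 0 1 * hh q 0 0) := by
  have := hh_row q 0 0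
  simp [Fin.sum_univ_two, eps, -Complex.coe_smul] at this
  rwa [← sub_eq_add_neg, sub_eq_zero] at this

lemma cd : hh q 1 0 * hh q 1 1 = (q : ℂ) • (hh q 1 1 * hh q 1 0) := by
  have := hh_row q 1 1
  simp [Fin.sum_univ_two, eps, -Complex.coe_smul] at this
  rwa [← sub_eq_add_neg, sub_eq_zero] at this

lemma ac : hh q 0 0 * hh q 1 0 = (q : ℂ) • (hh q 1 0 * hh q 0 0) := by
  have := hh_col q 0 0
  simp [Fin.sum_univ_two, eps, -Complex.coe_smul] at this
  rwa [← sub_eq_add_neg, sub_eq_zero] at this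

lemma bd : hh q 0 1 * hh q 1 1 = (q : ℂ) • (hh q 1 1 * hh q 0 1) := by
  have := hh_col q 1 1
  simp [Fin.sum_univ_two, eps, -Complex.coe_smul] at this
  rwa [← sub_eq_add_neg, sub_eq_zero] at this

lemma ad : hh q 0 0 * hh q 1 1 = (q : ℂ) • (hh q 0 1 * hh q 1 0) + 1 := by
  have := hh_row q 0 1
  simp [Fin.sum_univ_two, eps, -Complex.coe_smul] at this
  rwa [← sub_eq_add_neg, sub_eq_iff_eq_add'] at this

lemma ad' : hh q 0 0 * hh q 1 1 = (q : ℂ) • (hh q 1 0 * hh q 0 1) + 1 := by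
  have := hh_col q 0 1
  simp [Fin.sum_univ_two, eps, -Complex.coe_smul] at this
  rwa [← sub_eq_add_neg, sub_eq_iff_eq_add'] at this

lemma bc (hq : (q : ℂ) ≠ 0) : hh q 0 1 * hh q 1 0 = hh q 1 0 * hh q 0 1 := by
  have := (ad q).symm.trans (ad' q)
  simpa [hq, -Complex.coe_smul] using this

lemma da (hq : (q : ℂ) ≠ 0) : hh q 1 1 * hh q 0 0 = (q : ℂ)⁻¹ • (hh q 1 0 * hh q 0 1) + 1 := by
  have := hh_row q 1 0
  simp [Fin.sum_univ_two, eps, -Complex.coe_smul] at this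
  have h2 : (q : ℂ) • (hh q 1 1 * hh q 0 0) = hh q 1 0 * hh q 0 1 + (q : ℂ) • 1 := by
    rw [← sub_eq_zero] at this ⊢
    rw [← neg_eq_zero, ← this]
    abel
  rw [← inv_smul_smul₀ hq (hh q 1 1 * hh q 0 0), h2, smul_add, inv_smul_smul₀ hq]

end

/-! ### Part B2 -/

/-- `M_q(2)` relations for a 2 × 2 matrix. -/
structure IsQMat (q : ℝ) {E : Type} [Ring E] [Algebra ℂ E] (u : Fin 2 → Fin 2 → E) : Prop where
  col : ∀ k, u 0 k * u 1 k = (q : ℂ) • (u 1 k * u 0 k)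
  row : ∀ k, u k 0 * u k 1 = (q : ℂ) • (u k 1 * u k 0)
  comm : u 0 1 * u 1 0 = u 1 0 * u 0 1
  qcom : u 0 0 * u 1 1 - u 1 1 * u 0 0 = ((q : ℂ) - (q : ℂ)⁻¹) • (u 1 0 * u 0 1)
  det : u 0 0 * u 1 1 - (q : ℂ) • (u 1 0 * u 0 1) = 1

/-- Block diagonal 4 × 4 matrix. -/
def blk {E : Type} [Ring E] (u l : Fin 2 → Fin 2 → E) : Fin 4 → Fin 4 → E :=
  ![![u 0 0, u 0 1, 0, 0], ![u 1 0, u 1 1, 0, 0], ![0, 0, l 0 0, l 0 1], ![0, 0, l 1 0, l 1 1]]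

lemma blk_rel_col (q : ℝ) {E : Type} [Ring E] [Algebra ℂ E] (u l : Fin 2 → Fin 2 → E)
    (hu : IsQMat q u) (hl : IsQMat q l) (hc : ∀ i j k m, u i j * l k m = l k m * u i j)
    (i j k : Fin 4) (hij : i < j) :
    blk u l i k * blk u l j k = (q : ℂ) • (blk u l j k * blk u l i k) := by
  fin_cases i <;> fin_cases j <;> first | (exfalso; revert hij; decide) | skip
  all_goals fin_cases k <;> simp [blk, hu.col, hl.col, -Complex.coe_smul]

lemma blk_rel_row (q : ℝ) {E : Type} [Ring E] [Algebra ℂ E] (u l : Fin 2 → Fin 2 → E)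
    (hu : IsQMat q u) (hl : IsQMat q l) (hc : ∀ i j k m, u i j * l k m = l k m * u i j)
    (i j k : Fin 4) (hij : i < j) :
    blk u l k i * blk u l k j = (q : ℂ) • (blk u l k j * blk u l k i) := by
  fin_cases i <;> fin_cases j <;> first | (exfalso; revert hij; decide) | skip
  all_goals fin_cases k <;> simp [blk, hu.row, hl.row, -Complex.coe_smul]

lemma blk_rel_comm (q : ℝ) {E : Type} [Ring E] [Algebra ℂ E] (u l : Fin 2 → Fin 2 → E)
    (hu : IsQMat q u) (hl : IsQMat q l) (hc : ∀ i j k m, u i j * l k m = l k m * u i j)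
    (i j k m : Fin 4) (hij : i < j) (hkm : k < m) :
    blk u l i m * blk u l j k = blk u l j k * blk u l i m := by
  fin_cases i <;> fin_cases j <;> first | (exfalso; revert hij; decide) | skip
  all_goals fin_cases k <;> fin_cases m <;> first | (exfalso; revert hkm; decide) | skip
  all_goals simp [blk, hu.comm, hl.comm, hc]

lemma blk_rel_qcom (q : ℝ) {E : Type} [Ring E] [Algebra ℂ E] (u l : Fin 2 → Fin 2 → E)
    (hu : IsQMat q u) (hl : IsQMat q l) (hc : ∀ i j k m, u i j * l k m = l k m * u i j)
    (i j k m : Fin 4) (hij : i < j) (hkm : k < m) :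
    blk u l i k * blk u l j m - blk u l j m * blk u l i k =
      ((q : ℂ) - (q : ℂ)⁻¹) • (blk u l j k * blk u l i m) := by
  fin_cases i <;> fin_cases j <;> first | (exfalso; revert hij; decide) | skip
  all_goals fin_cases k <;> fin_cases m <;> first | (exfalso; revert hkm; decide) | skip
  all_goals simp [blk, hu.qcom, hl.qcom, hc, -Complex.coe_smul]

lemma perm_sum {E : Type} [AddCommMonoid E] (f : Equiv.Perm (Fin 4) → E)
    (hf : ∀ σ : Equiv.Perm (Fin 4), (2 ≤ σ 0 ∨ 2 ≤ σ 1) → f σ = 0) :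
    ∑ σ, f σ = f 1 + f (Equiv.swap 0 1) + f (Equiv.swap 2 3) +
      f (Equiv.swap 0 1 * Equiv.swap 2 3) := by
  have h1 : ∑ σ, f σ = ∑ σ ∈ ({1, Equiv.swap 0 1, Equiv.swap 2 3,
      Equiv.swap 0 1 * Equiv.swap 2 3} : Finset (Equiv.Perm (Fin 4))), f σ := by
    symm
    apply Finset.sum_subset (Finset.subset_univ _)
    intro σ _ hσ
    apply hf
    revert σ
    decide
  rw [h1, Finset.sum_insert (by decide), Finset.sum_insert (by decide),
    Finset.sum_insert (by decide), Finset.sum_singleton]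
  abel

lemma plen1 : plen 1 = 0 := by decide
lemma plen2 : plen (Equiv.swap 0 1) = 1 := by decide
lemma plen3 : plen (Equiv.swap 2 3) = 1 := by decide
lemma plen4 : plen (Equiv.swap 0 1 * Equiv.swap 2 3) = 2 := by decide

lemma pv4 : (Equiv.swap 0 1 * Equiv.swap 2 3 : Equiv.Perm (Fin 4)) 0 = 1 ∧
  (Equiv.swap 0 1 * Equiv.swap 2 3 : Equiv.Perm (Fin 4)) 1 = 0 ∧
  (Equiv.swap 0 1 * Equiv.swap 2 3 : Equiv.Perm (Fin 4)) 2 = 3 ∧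
  (Equiv.swap 0 1 * Equiv.swap 2 3 : Equiv.Perm (Fin 4)) 3 = 2 := by decide
lemma pv2 : (Equiv.swap 0 1 : Equiv.Perm (Fin 4)) 0 = 1 ∧
  (Equiv.swap 0 1 : Equiv.Perm (Fin 4)) 1 = 0 ∧
  (Equiv.swap 0 1 : Equiv.Perm (Fin 4)) 2 = 2 ∧
  (Equiv.swap 0 1 : Equiv.Perm (Fin 4)) 3 = 3 := by decide
lemma pv3 : (Equiv.swap 2 3 : Equiv.Perm (Fin 4)) 0 = 0 ∧
  (Equiv.swap 2 3 : Equiv.Perm (Fin 4)) 1 = 1 ∧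
  (Equiv.swap 2 3 : Equiv.Perm (Fin 4)) 2 = 3 ∧
  (Equiv.swap 2 3 : Equiv.Perm (Fin 4)) 3 = 2 := by decide

/-- Expansion of a quantum determinant whose off-block terms vanish (after any additive map). -/
lemma perm_sum_det (q : ℝ) {E M : Type} [Ring E] [Algebra ℂ E] [AddCommGroup M] [Module ℂ M]
    (φ : E →ₗ[ℂ] M) (x : Fin 4 → Fin 4 → E)
    (h : ∀ σ : Equiv.Perm (Fin 4), (2 ≤ σ 0 ∨ 2 ≤ σ 1) →
      φ (x (σ 0) 0 * x (σ 1) 1 * x (σ 2) 2 * x (σ 3) 3) = 0) :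
    φ (∑ σ : Equiv.Perm (Fin 4),
      ((-(q : ℂ)) ^ plen σ) • (x (σ 0) 0 * x (σ 1) 1 * x (σ 2) 2 * x (σ 3) 3)) =
    φ ((x 0 0 * x 1 1 - (q : ℂ) • (x 1 0 * x 0 1)) *
      (x 2 2 * x 3 3 - (q : ℂ) • (x 3 2 * x 2 3))) := by
  rw [map_sum, perm_sum]
  · rw [plen1, plen2, plen3, plen4]
    simp only [pv2.1, pv2.2.1, pv2.2.2.1, pv2.2.2.2, pv3.1, pv3.2.1, pv3.2.2.1, pv3.2.2.2,
      pv4.1, pv4.2.1, pv4.2.2.1, pv4.2.2.2, Equiv.Perm.one_apply]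
    simp only [← map_add]
    congr 1
    simp only [sub_mul, mul_sub, smul_mul_assoc, mul_smul_comm, mul_assoc]
    module
  · intro σ hσ
    rw [map_smul, h σ hσ, smul_zero]

theorem exists_blk (q : ℝ) {E : Type} [Ring E] [Algebra ℂ E] (u l : Fin 2 → Fin 2 → E)
    (hu : IsQMat q u) (hl : IsQMat q l) (hc : ∀ i j k m, u i j * l k m = l k m * u i j) :
    ∃ Φ : AU q →ₐ[ℂ] E, ∀ i j, Φ (tt q i j) = blk u l i j := by
  let φ : FU →ₐ[ℂ] E := FreeAlgebra.lift ℂ (Sum.elim (fun p => blk u l p.1 p.2) fun _ => 1)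
  have hφ : ∀ i j, φ (T i j) = blk u l i j := fun a b => by simp [φ, T]
  have hφD : φ Dinv0 = 1 := by simp [φ, Dinv0]
  have hD : φ (Dq0 q) = 1 := by
    rw [Dq0]
    have := perm_sum_det q φ.toLinearMap T ?_
    · simp only [AlgHom.toLinearMap_apply] at this
      rw [this]
      simp only [map_mul, map_sub, map_smul, hφ]
      have e1 := hu.det
      have e2 := hl.det
      change (u 0 0 * u 1 1 - (q : ℂ) • (u 1 0 * u 0 1)) *
        (l 0 0 * l 1 1 - (q : ℂ) • (l 1 0 * l 0 1)) = 1
      rw [e1, e2, one_mul]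
    · intro σ hσ
      simp only [AlgHom.toLinearMap_apply, map_mul, hφ]
      have z0 : ∀ i : Fin 4, 2 ≤ i → blk u l i 0 = 0 := by
        intro i hi; fin_cases i <;> first | rfl | (exfalso; revert hi; decide)
      have z1 : ∀ i : Fin 4, 2 ≤ i → blk u l i 1 = 0 := by
        intro i hi; fin_cases i <;> first | rfl | (exfalso; revert hi; decide)
      rcases hσ with h | h
      · rw [z0 _ h]; simp
      · rw [z1 _ h]; simp
  refine ⟨RingQuot.liftAlgHom ℂ ⟨φ, ?_⟩, ?_⟩
  · intro x y h
    induction h with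
    | col h => simpa only [map_smul, map_mul, hφ] using blk_rel_col q u l hu hl hc _ _ _ h
    | row h => simpa only [map_smul, map_mul, hφ] using blk_rel_row q u l hu hl hc _ _ _ h
    | comm h h' => simpa only [map_mul, hφ] using blk_rel_comm q u l hu hl hc _ _ _ _ h h'
    | qcom h h' =>
      simpa only [map_smul, map_sub, map_mul, hφ] using blk_rel_qcom q u l hu hl hc _ _ _ _ h h'
    | dr => rw [map_mul, hD, hφD, one_mul, map_one]
    | dl => rw [map_mul, hD, hφD, one_mul, map_one]
  · intro a b
    rw [tt, RingQuot.liftAlgHom_mkAlgHom_apply, hφ]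

/-- Upper block: right multiplication. -/
def uu (q : ℝ) (i j : Fin 2) : (Module.End ℂ (HH q))ᵐᵒᵖ :=
  MulOpposite.op (LinearMap.mulRight ℂ (hh q i j))

/-- Matrix acting by left multiplication in the lower block. -/
def hl (q : ℝ) : Fin 2 → Fin 2 → HH q := ![![hh q 1 1, - hh q 1 0], ![- hh q 0 1, hh q 0 0]]

/-- Lower block: left multiplication. -/
def ll (q : ℝ) (i j : Fin 2) : (Module.End ℂ (HH q))ᵐᵒᵖ :=
  MulOpposite.op (LinearMap.mulLeft ℂ (hl q i j))

lemma da_ad (q : ℝ) (hq : (q : ℂ) ≠ 0) : hh q 0 0 * hh q 1 1 - hh q 1 1 * hh q 0 0 =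
    ((q : ℂ) - (q : ℂ)⁻¹) • (hh q 1 0 * hh q 0 1) := by
  rw [ad', da q hq]; module

lemma uu_q (q : ℝ) (hq : (q : ℂ) ≠ 0) : IsQMat q (uu q) := by
  have key : ∀ x y : HH q, MulOpposite.op (LinearMap.mulRight ℂ x) *
    MulOpposite.op (LinearMap.mulRight ℂ y) = MulOpposite.op (LinearMap.mulRight ℂ (x * y)) := by
    intro x y; rw [← MulOpposite.op_mul]; congr 1; ext z; simp [mul_assoc]
  have ks : ∀ (a : ℂ) (x : HH q), a • MulOpposite.op (LinearMap.mulRight ℂ x) =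
     MulOpposite.op (LinearMap.mulRight ℂ (a • x)) := by
    intro x y; rw [← MulOpposite.op_smul]; congr 1; ext z; simp
  have kd : ∀ (y x : HH q), MulOpposite.op (LinearMap.mulRight ℂ y) -
     MulOpposite.op (LinearMap.mulRight ℂ x) = MulOpposite.op (LinearMap.mulRight ℂ (y - x)) := by
    intro x y; rw [← MulOpposite.op_sub]; congr 1; ext z; simp [mul_sub]
  constructor
  · intro k; simp only [uu, key, ks]; fin_cases k
    · exact congrArg _ (congrArg _ (ac q))
    · exact congrArg _ (congrArg _ (bd q))
  · intro k; simp only [uu, key, ks]; fin_cases k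
    · exact congrArg _ (congrArg _ (ab q))
    · exact congrArg _ (congrArg _ (cd q))
  · simp only [uu, key, bc q hq]
  · simp only [uu, key, ks, kd, da_ad q hq]
  · simp only [uu, key, ks, kd, ad', add_sub_cancel_left]
    rw [LinearMap.mulRight_one]; rfl

lemma ll_q (q : ℝ) (hq : (q : ℂ) ≠ 0) : IsQMat q (ll q) := by
  have key : ∀ x y : HH q, MulOpposite.op (LinearMap.mulLeft ℂ x) *
    MulOpposite.op (LinearMap.mulLeft ℂ y) = MulOpposite.op (LinearMap.mulLeft ℂ (y * x)) := by
    intro x y; rw [← MulOpposite.op_mul]; congr 1; ext z; simp [mul_assoc]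
  have ks : ∀ (a : ℂ) (x : HH q), a • MulOpposite.op (LinearMap.mulLeft ℂ x) =
     MulOpposite.op (LinearMap.mulLeft ℂ (a • x)) := by
    intro x y; rw [← MulOpposite.op_smul]; congr 1; ext z; simp
  have kd : ∀ (y x : HH q), MulOpposite.op (LinearMap.mulLeft ℂ y) -
     MulOpposite.op (LinearMap.mulLeft ℂ x) = MulOpposite.op (LinearMap.mulLeft ℂ (y - x)) := by
    intro x y; rw [← MulOpposite.op_sub]; congr 1; ext z; simp [sub_mul]
  constructor
  · intro k; simp only [ll, key, ks]; congr 2; fin_cases k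
    · simp [hl, bd q, -Complex.coe_smul]
    · simp [hl, ac q, -Complex.coe_smul]
  · intro k; simp only [ll, key, ks]; congr 2; fin_cases k
    · simp [hl, cd q, -Complex.coe_smul]
    · simp [hl, ab q, -Complex.coe_smul]
  · simp only [ll, key]; congr 2; simp [hl, bc q hq]
  · simp only [ll, key, ks, kd]; congr 2; simpa [hl, -Complex.coe_smul] using da_ad q hq
  · simp only [ll, key, ks, kd]
    rw [show (1 : (Module.End ℂ (HH q))ᵐᵒᵖ) = MulOpposite.op (LinearMap.mulLeft ℂ 1) by
      rw [LinearMap.mulLeft_one]; rfl]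
    congr 2; simp [hl, ad' q, -Complex.coe_smul]

lemma ul_comm (q : ℝ) (i j k m) : uu q i j * ll q k m = ll q k m * uu q i j := by
  rw [uu, ll, ← MulOpposite.op_mul, ← MulOpposite.op_mul]
  congr 1; ext z; simp [mul_assoc]

theorem exists_rho (q : ℝ) (hq : (q : ℂ) ≠ 0) :
    ∃ Φ : AU q →ₐ[ℂ] (Module.End ℂ (HH q))ᵐᵒᵖ, ∀ i j, Φ (tt q i j) = blk (uu q) (ll q) i j :=
  exists_blk q _ _ (uu_q q hq) (ll_q q hq) (ul_comm q)


/-! ### Part B3 -/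

section
variable (q : ℝ)

lemma tt_col {i j k : Fin 4} (h : i < j) :
    tt q i k * tt q j k = (q : ℂ) • (tt q j k * tt q i k) := by
  have := RingQuot.mkAlgHom_rel ℂ (relU.col (q := q) (k := k) h)
  rwa [map_mul, map_smul, map_mul] at this

lemma tt_row {i j k : Fin 4} (h : i < j) :
    tt q k i * tt q k j = (q : ℂ) • (tt q k j * tt q k i) := by
  have := RingQuot.mkAlgHom_rel ℂ (relU.row (q := q) (k := k) h)
  rwa [map_mul, map_smul, map_mul] at this

lemma tt_comm {i j k l : Fin 4} (h : i < j) (h' : k < l) :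
    tt q i l * tt q j k = tt q j k * tt q i l := by
  have := RingQuot.mkAlgHom_rel ℂ (relU.comm (q := q) h h')
  rwa [map_mul, map_mul] at this

lemma tt_qcom {i j k l : Fin 4} (h : i < j) (h' : k < l) :
    tt q i k * tt q j l - tt q j l * tt q i k =
      ((q : ℂ) - (q : ℂ)⁻¹) • (tt q j k * tt q i l) := by
  have := RingQuot.mkAlgHom_rel ℂ (relU.qcom (q := q) h h')
  rwa [map_sub, map_smul, map_mul, map_mul, map_mul] at this

lemma Dq_dI : Dq q * dI q = 1 := by
  have := RingQuot.mkAlgHom_rel ℂ (relU.dr (q := q))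
  rwa [map_mul, map_one] at this

lemma Dq_eq : Dq q = ∑ σ : Equiv.Perm (Fin 4),
    ((-(q : ℂ)) ^ plen σ) • (tt q (σ 0) 0 * tt q (σ 1) 1 * tt q (σ 2) 2 * tt q (σ 3) 3) := by
  simp only [Dq, Dq0, map_sum, map_smul, map_mul, tt]

/-- Embedding of the upper block indices. -/
def e2 : Fin 2 → Fin 4 := ![0, 1]

/-- The words in the upper block. -/
def up : FreeAlgebra ℂ (Fin 2 × Fin 2) →ₐ[ℂ] AU q :=
  FreeAlgebra.lift ℂ fun p => tt q (e2 p.1) (e2 p.2)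

lemma up_ι (p) : up q (FreeAlgebra.ι ℂ p) = tt q (e2 p.1) (e2 p.2) := by simp [up]

/-- Off-diagonal block positions. -/
def Off (i j : Fin 4) : Prop := (i < 2 ∧ 2 ≤ j) ∨ (j < 2 ∧ 2 ≤ i)

/-- The right ideal generated by off-diagonal entries. -/
def OI : Submodule ℂ (AU q) := Submodule.span ℂ {y | ∃ i j, Off i j ∧ ∃ a, y = tt q i j * a}

lemma OI_mem {i j} (h : Off i j) (a : AU q) : tt q i j * a ∈ OI q :=
  Submodule.subset_span ⟨i, j, h, a, rfl⟩

lemma OI_mem' {i j} (h : Off i j) : tt q i j ∈ OI q := by simpa using OI_mem q h 1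

lemma OI_right {y : AU q} (hy : y ∈ OI q) (c : AU q) : y * c ∈ OI q := by
  induction hy using Submodule.span_induction with
  | mem x hx =>
      obtain ⟨i, j, h, a, rfl⟩ := hx
      rw [mul_assoc]; exact OI_mem q h _
  | zero => simp
  | add u v _ _ hu hv => simpa [add_mul] using (OI q).add_mem hu hv
  | smul a u _ hu => simpa [smul_mul_assoc] using (OI q).smul_mem a hu

lemma e2_lt (i : Fin 2) : e2 i < 2 := by fin_cases i <;> decide

lemma up_off {i j k l : Fin 4} (hi : i < 2) (hj : j < 2) (h : Off k l) :
    tt q i j * tt q k l ∈ OI q := by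
  rcases h with ⟨hk, hl⟩ | ⟨hl, hk⟩
  · have hjl : j < l := lt_of_lt_of_le hj hl
    rcases lt_trichotomy i k with h | h | h
    · rw [← sub_add_cancel (tt q i j * tt q k l) (tt q k l * tt q i j), tt_qcom q h hjl,
        ← tt_comm q h hjl]
      exact (OI q).add_mem ((OI q).smul_mem _ (OI_mem q (Or.inl ⟨hi, hl⟩) _))
        (OI_mem q (Or.inl ⟨hk, hl⟩) _)
    · subst h; rw [tt_row q hjl]
      exact (OI q).smul_mem _ (OI_mem q (Or.inl ⟨hk, hl⟩) _)
    · rw [← tt_comm q h hjl]; exact (OI_mem q (Or.inl ⟨hk, hl⟩) _)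
  · have hik : i < k := lt_of_lt_of_le hi hk
    rcases lt_trichotomy j l with h | h | h
    · rw [← sub_add_cancel (tt q i j * tt q k l) (tt q k l * tt q i j), tt_qcom q hik h]
      exact (OI q).add_mem ((OI q).smul_mem _ (OI_mem q (Or.inr ⟨hj, hk⟩) _))
        (OI_mem q (Or.inr ⟨hl, hk⟩) _)
    · subst h; rw [tt_col q hik]
      exact (OI q).smul_mem _ (OI_mem q (Or.inr ⟨hl, hk⟩) _)
    · rw [tt_comm q hik h]; exact (OI_mem q (Or.inr ⟨hl, hk⟩) _)

lemma up_OI (x : FreeAlgebra ℂ (Fin 2 × Fin 2)) {y : AU q} (hy : y ∈ OI q) :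
    up q x * y ∈ OI q := by
  induction x using FreeAlgebra.induction generalizing y with
  | grade0 r =>
    rw [AlgHom.commutes, ← Algebra.smul_def]; exact (OI q).smul_mem _ hy
  | grade1 p =>
    rw [up_ι]
    induction hy using Submodule.span_induction with
    | mem x hx =>
        obtain ⟨i, j, h, a, rfl⟩ := hx
        rw [← mul_assoc]; exact OI_right q (up_off q (e2_lt _) (e2_lt _) h) a
    | zero => simp
    | add u v _ _ hu hv => simpa [mul_add] using (OI q).add_mem hu hv
    | smul a u _ hu => rw [mul_smul_comm]; exact (OI q).smul_mem a hu
  | mul a b ha hb => rw [map_mul, mul_assoc]; exact ha (hb hy)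
  | add a b ha hb => rw [map_add, add_mul]; exact (OI q).add_mem (ha hy) (hb hy)

lemma up_low (x : FreeAlgebra ℂ (Fin 2 × Fin 2)) {k l : Fin 4} (hk : 2 ≤ k) (hl : 2 ≤ l) :
    up q x * tt q k l - tt q k l * up q x ∈ OI q := by
  induction x using FreeAlgebra.induction with
  | grade0 r =>
    rw [AlgHom.commutes, Algebra.commutes, sub_self]; exact (OI q).zero_mem
  | grade1 p =>
    rw [up_ι, tt_qcom q (lt_of_lt_of_le (e2_lt _) hk) (lt_of_lt_of_le (e2_lt _) hl)]
    exact (OI q).smul_mem _ (OI_mem q (Or.inr ⟨e2_lt _, hk⟩) _)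
  | mul a b ha hb =>
    have := (OI q).add_mem (up_OI q a hb) (OI_right q ha (up q b))
    convert this using 1
    rw [map_mul]; noncomm_ring
  | add a b ha hb =>
    have := (OI q).add_mem ha hb
    convert this using 1
    rw [map_add]; noncomm_ring

/-- The quantum determinant of the upper block. -/
def dt : AU q := tt q 0 0 * tt q 1 1 - (q : ℂ) • (tt q 0 1 * tt q 1 0)

lemma l01 : (0 : Fin 4) < 1 := by decide

lemma dt_aux {E : Type} [Ring E] [Algebra ℂ E] (k : ℂ) (hk : k ≠ 0) (a b c d : E)
    (cab : a * b = k • (b * a)) (ccd : c * d = k • (d * c)) (cac : a * c = k • (c * a))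
    (cbd : b * d = k • (d * b)) (cbc : b * c = c * b) (cad : a * d - d * a = (k - k⁻¹) • (c * b)) :
    let x := a * d - k • (b * c); (a * x = x * a ∧ b * x = x * b) ∧ (c * x = x * c ∧ d * x = x * d) := by
  rw [sub_eq_iff_eq_add] at cad
  have t1 := fun x => congrArg (· * x) cab
  have t2 := fun x => congrArg (· * x) ccd
  have t3 := fun x => congrArg (· * x) cac
  have t4 := fun x => congrArg (· * x) cbd
  have t5 := fun x => congrArg (· * x) cbc
  have t6 := fun x => congrArg (· * x) cad
  simp only [mul_assoc, smul_mul_assoc, add_mul] at t1 t2 t3 t4 t5 t6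
  refine ⟨⟨?_, ?_⟩, ?_, ?_⟩ <;>
    simp only [mul_sub, sub_mul, mul_smul_comm, smul_mul_assoc, mul_assoc, add_mul, t1, t2, t3, t4, t5,
      t6, cab, ccd, cac, cbd, cbc, cad, mul_add, smul_add, smul_smul] <;>
    match_scalars <;> field_simp <;> ring

lemma dt_comm1 (hq : (q : ℂ) ≠ 0) (i j : Fin 2) :
    tt q (e2 i) (e2 j) * dt q = dt q * tt q (e2 i) (e2 j) := by
  have := dt_aux (q : ℂ) hq (tt q 0 0) (tt q 0 1) (tt q 1 0) (tt q 1 1)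
    (tt_row q l01) (tt_row q l01) (tt_col q l01) (tt_col q l01) (tt_comm q l01 l01)
    (tt_qcom q l01 l01)
  fin_cases i <;> fin_cases j
  exacts [this.1.1, this.1.2, this.2.1, this.2.2]
end

/-! ### Part B3b -/

section
variable (q : ℝ)

lemma up_dt (hq : (q : ℂ) ≠ 0) (x : FreeAlgebra ℂ (Fin 2 × Fin 2)) :
    up q x * dt q = dt q * up q x := by
  induction x using FreeAlgebra.induction with
  | grade0 r => rw [AlgHom.commutes, Algebra.commutes]
  | grade1 p => rw [up_ι, dt_comm1 q hq]
  | mul a b ha hb => rw [map_mul (up q), mul_assoc, hb, ← mul_assoc, ha, mul_assoc]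
  | add a b ha hb => rw [map_add, add_mul, ha, hb, mul_add]

lemma rr_zero {y : AU q} (h : y ∈ RIdeal q) : rr q y = 0 := by
  simpa [rr] using h

lemma rr_R {x : AU q} (h : x ∈ Rset q) (a : AU q) : rr q (x * a) = 0 :=
  rr_zero q (Submodule.subset_span ⟨x, h, a, rfl⟩)

lemma rr_off {i j : Fin 4} (h : Off i j) (a : AU q) : rr q (tt q i j * a) = 0 := by
  apply rr_R
  rcases h with ⟨h1, h2⟩ | ⟨h1, h2⟩ <;> fin_cases i <;> fin_cases j <;>
    first | (exfalso; revert h1 h2; decide) | simp [Rset]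

lemma rr_OI {y : AU q} (h : y ∈ OI q) : rr q y = 0 := by
  induction h using Submodule.span_induction with
  | mem x hx => obtain ⟨i, j, h, a, rfl⟩ := hx; exact rr_off q h a
  | zero => simp
  | add u v _ _ hu hv => rw [map_add, hu, hv, add_zero]
  | smul a u _ hu => rw [map_smul, hu, smul_zero]

lemma rr_low (x : FreeAlgebra ℂ (Fin 2 × Fin 2)) {k l : Fin 4} (hk : 2 ≤ k) (hl : 2 ≤ l) :
    rr q (up q x * tt q k l) = rr q (tt q k l * up q x) := by
  rw [← sub_eq_zero, ← map_sub]; exact rr_OI q (up_low q x hk hl)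

lemma rr_22 (a : AU q) : rr q (tt q 2 2 * a) = rr q (tt q 1 1 * a) := by
  rw [eq_comm, ← sub_eq_zero, ← map_sub, ← sub_mul]; exact rr_R q (by simp [Rset]) a
lemma rr_33 (a : AU q) : rr q (tt q 3 3 * a) = rr q (tt q 0 0 * a) := by
  rw [eq_comm, ← sub_eq_zero, ← map_sub, ← sub_mul]; exact rr_R q (by simp [Rset]) a
lemma rr_32 (a : AU q) : rr q (tt q 3 2 * a) = - rr q (tt q 0 1 * a) := by
  rw [eq_neg_iff_add_eq_zero, add_comm, ← map_add, ← add_mul]; exact rr_R q (by simp [Rset]) a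
lemma rr_23 (a : AU q) : rr q (tt q 2 3 * a) = - rr q (tt q 1 0 * a) := by
  rw [eq_neg_iff_add_eq_zero, add_comm, ← map_add, ← add_mul]; exact rr_R q (by simp [Rset]) a
lemma rr_dt (a : AU q) : rr q (dt q * a) = rr q a := by
  have := rr_R q (x := dt q - 1) (by simp [Rset, dt]) a
  rwa [sub_mul, one_mul, map_sub, sub_eq_zero] at this

lemma rr_mul_congr {x y : AU q} (h : rr q x = rr q y) (a : AU q) : rr q (x * a) = rr q (y * a) := by
  rw [← cact_mk, h, cact_mk]

/-- Free upper generators. -/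
def H1 (i j : Fin 2) : FreeAlgebra ℂ (Fin 2 × Fin 2) := FreeAlgebra.ι ℂ (i, j)
lemma up00 : up q (H1 0 0) = tt q 0 0 := up_ι q (0, 0)
lemma up01 : up q (H1 0 1) = tt q 0 1 := up_ι q (0, 1)
lemma up10 : up q (H1 1 0) = tt q 1 0 := up_ι q (1, 0)
lemma up11 : up q (H1 1 1) = tt q 1 1 := up_ι q (1, 1)

lemma dt_up : dt q = up q (H1 0 0 * H1 1 1 - (q : ℂ) • (H1 0 1 * H1 1 0)) := by
  simp only [map_sub, map_mul, map_smul, up00, up01, up10, up11, dt]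

lemma rr_up_dt (hq : (q : ℂ) ≠ 0) (x : FreeAlgebra ℂ (Fin 2 × Fin 2)) :
    rr q (up q x * dt q) = rr q (up q x) := by
  rw [up_dt q hq, rr_dt]

lemma l22 : (2 : Fin 4) ≤ 2 := by decide
lemma l23 : (2 : Fin 4) ≤ 3 := by decide

lemma rr_ldt (hq : (q : ℂ) ≠ 0) (x : FreeAlgebra ℂ (Fin 2 × Fin 2)) :
    rr q (up q x * (tt q 2 2 * tt q 3 3 - (q : ℂ) • (tt q 3 2 * tt q 2 3))) = rr q (up q x) := by
  rw [mul_sub, mul_smul_comm, map_sub, map_smul, ← mul_assoc, ← mul_assoc]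
  have h1 : rr q (up q x * tt q 2 2 * tt q 3 3) = rr q (tt q 0 0 * tt q 1 1 * up q x) := by
    rw [rr_mul_congr q ((rr_low q x l22 l22).trans (rr_22 q _)), ← up11, ← map_mul (up q),
      rr_low q _ l23 l23, rr_33, mul_assoc, map_mul (up q)]
  have h2 : rr q (up q x * tt q 3 2 * tt q 2 3) = rr q (tt q 0 1 * tt q 1 0 * up q x) := by
    have e : rr q (up q x * tt q 3 2) = rr q (-(tt q 0 1 * up q x)) := by
      rw [rr_low q x l23 l22, rr_32, map_neg]
    rw [rr_mul_congr q e, ← up01, neg_mul, ← map_mul (up q), map_neg, 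
      rr_low q _ l22 l23, rr_23, neg_neg, map_mul (up q), up01, tt_comm q l01 l01, mul_assoc]
  rw [h1, h2, ← map_smul, ← map_sub, ← smul_mul_assoc, ← sub_mul]
  exact rr_dt q _

lemma rr_D (hq : (q : ℂ) ≠ 0) (x : FreeAlgebra ℂ (Fin 2 × Fin 2)) :
    rr q (up q x * Dq q) = rr q (up q x) := by
  have := perm_sum_det q (rr q ∘ₗ LinearMap.mulLeft ℂ (up q x)) (tt q) ?_
  · rw [← Dq_eq] at this
    simp only [LinearMap.comp_apply, LinearMap.mulLeft_apply] at this
    rw [this, ← tt_comm q l01 l01]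
    change rr q (up q x * (dt q * _)) = _
    rw [← mul_assoc, dt_up, ← map_mul (up q), rr_ldt q hq, map_mul (up q), ← dt_up, rr_up_dt q hq]
  · intro σ h
    simp only [LinearMap.comp_apply, LinearMap.mulLeft_apply]
    apply rr_OI
    by_cases h0 : 2 ≤ σ 0
    · simp only [← mul_assoc]
      exact OI_right q (OI_right q (OI_right q (up_OI q x (OI_mem' q (Or.inr ⟨by decide, h0⟩))) _) _) _
    · have h1 : 2 ≤ σ 1 := h.resolve_left h0
      have : ∃ p, tt q (σ 0) 0 = up q p := by
        have : σ 0 = 0 ∨ σ 0 = 1 := by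
          clear h; generalize σ 0 = i at *; revert h0; revert i; decide
        rcases this with h | h <;> rw [h]
        exacts [⟨_, (up00 q).symm⟩, ⟨_, (up10 q).symm⟩]
      obtain ⟨p, hp⟩ := this
      rw [hp]
      simp only [← mul_assoc, ← map_mul (up q)]
      exact OI_right q (OI_right q (up_OI q _ (OI_mem' q (Or.inr ⟨by decide, h1⟩))) _) _

lemma rr_dI (hq : (q : ℂ) ≠ 0) (x : FreeAlgebra ℂ (Fin 2 × Fin 2)) :
    rr q (up q x * dI q) = rr q (up q x) := by
  rw [← rr_mul_congr q (rr_D q hq x), mul_assoc, Dq_dI, mul_one]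

lemma rr_up_surj (hq : (q : ℂ) ≠ 0) (y : AU q) : ∃ x, rr q y = rr q (up q x) := by
  let M : Submodule ℂ (AU q) :=
    (LinearMap.range (rr q ∘ₗ (up q).toLinearMap)).comap (rr q)
  have hM : ∀ y, y ∈ M ↔ ∃ x, rr q y = rr q (up q x) := by
    intro y; simp [M, eq_comm]
  rw [← hM]
  refine quot_gen _ M ((hM _).2 ⟨1, by simp⟩) ?_ y
  intro y hy g
  obtain ⟨x, hx⟩ := (hM _).1 hy
  rw [hM, rr_mul_congr q hx]
  rcases g with ⟨i, j⟩ | g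
  · change ∃ x', rr q (up q x * tt q i j) = _
    by_cases ho : Off i j
    · exact ⟨0, by rw [map_zero, map_zero]; exact rr_OI q (up_OI q x (OI_mem' q ho))⟩
    by_cases hi : 2 ≤ i
    · have hj : 2 ≤ j := by
        by_contra h; exact ho (Or.inr ⟨not_le.1 h, hi⟩)
      rw [rr_low q x hi hj]
      have : (i = 2 ∨ i = 3) ∧ (j = 2 ∨ j = 3) := by
        constructor
        · revert hi; clear ho; revert i; decide
        · revert hj; clear ho; revert j; decide
      rcases this with ⟨rfl | rfl, rfl | rfl⟩
      · exact ⟨H1 1 1 * x, by rw [rr_22, map_mul (up q), up11]⟩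
      · exact ⟨-(H1 1 0 * x), by rw [rr_23, map_neg, map_mul (up q), up10, map_neg]⟩
      · exact ⟨-(H1 0 1 * x), by rw [rr_32, map_neg, map_mul (up q), up01, map_neg]⟩
      · exact ⟨H1 0 0 * x, by rw [rr_33, map_mul (up q), up00]⟩
    · have hj : ¬ 2 ≤ j := by
        intro h; exact ho (Or.inl ⟨not_le.1 hi, h⟩)
      have : (i = 0 ∨ i = 1) ∧ (j = 0 ∨ j = 1) := by
        constructor
        · revert hi; clear ho; revert i; decide
        · revert hj; clear ho; revert j; decide
      rcases this with ⟨rfl | rfl, rfl | rfl⟩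
      · exact ⟨x * H1 0 0, by rw [map_mul (up q), up00]⟩
      · exact ⟨x * H1 0 1, by rw [map_mul (up q), up01]⟩
      · exact ⟨x * H1 1 0, by rw [map_mul (up q), up10]⟩
      · exact ⟨x * H1 1 1, by rw [map_mul (up q), up11]⟩
  · exact ⟨x, rr_dI q hq x⟩

lemma tt_eps_row (hq : (q : ℂ) ≠ 0) (i j : Fin 2) :
    ∑ a, ∑ b, eps q a b • (tt q (e2 i) (e2 a) * tt q (e2 j) (e2 b)) = eps q i j • dt q := by
  have cbc := tt_comm q l01 l01
  have cad := tt_qcom q l01 l01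
  rw [sub_eq_iff_eq_add] at cad
  fin_cases i <;> fin_cases j <;>
    simp [Fin.sum_univ_two, eps, e2, dt, -Complex.coe_smul, tt_row q l01, cbc, cad] <;>
    match_scalars <;> field_simp <;> ring

lemma tt_eps_col (hq : (q : ℂ) ≠ 0) (a b : Fin 2) :
    ∑ i, ∑ j, eps q i j • (tt q (e2 i) (e2 a) * tt q (e2 j) (e2 b)) = eps q a b • dt q := by
  have cbc := tt_comm q l01 l01
  have cad := tt_qcom q l01 l01
  rw [sub_eq_iff_eq_add] at cad
  fin_cases a <;> fin_cases b <;>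
    simp [Fin.sum_univ_two, eps, e2, dt, -Complex.coe_smul, tt_col q l01, cbc, cad] <;>
    match_scalars <;> field_simp <;> ring

theorem exists_g (hq : (q : ℂ) ≠ 0) :
    ∃ (ρ : AU q →ₐ[ℂ] (Module.End ℂ (HH q))ᵐᵒᵖ) (g : Cq q ≃ₗ[ℂ] HH q),
      (∀ i j, ρ (tt q i j) = blk (uu q) (ll q) i j) ∧
      ∀ w, g (rr q w) = (ρ w).unop 1 := by
  obtain ⟨ρ, hρ⟩ := exists_rho q hq
  let γ : AU q →ₗ[ℂ] HH q := 
    { toFun := fun w => (ρ w).unop 1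
      map_add' := by intro x y; simp
      map_smul' := by intro c x; simp }
  have hγ : ∀ w, γ w = (ρ w).unop 1 := fun _ => rfl
  have hmul : ∀ x y, γ (x * y) = (ρ y).unop (γ x) := by
    intro x y; rw [hγ, map_mul]; rfl
  have hRs : ∀ x ∈ Rset q, γ x = 0 := by
    intro x hx
    simp only [Rset, Set.mem_insert_iff, Set.mem_singleton_iff] at hx
    rcases hx with rfl|rfl|rfl|rfl|rfl|rfl|rfl|rfl|rfl|rfl|rfl|rfl|rfl
    case inr.inr.inr.inr.inr.inr.inr.inr.inr.inr.inr.inr => 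
      have := ad q
      simp [hγ, hρ, blk, uu, this, -Complex.coe_smul]
    all_goals simp [hγ, hρ, blk, uu, ll, hl]
  have hk : RIdeal q ≤ LinearMap.ker γ := by
    refine Submodule.span_le.2 ?_
    rintro _ ⟨x, hx, a, rfl⟩
    simp [hmul, hRs x hx]
  let g : Cq q →ₗ[ℂ] HH q := Submodule.liftQ _ γ hk
  have hg : ∀ w, g (rr q w) = γ w := fun w => Submodule.liftQ_apply _ _ _
  have hup : ∀ w a b, γ (w * tt q (e2 a) (e2 b)) = γ w * hh q a b := by
    intro w a b
    rw [hmul, hρ]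
    fin_cases a <;> fin_cases b <;> simp [blk, e2, uu]
  have hsurj : Function.Surjective g := by
    intro y
    have := hh_gen q (LinearMap.range γ) ⟨1, by simp [hγ]⟩ (by
      rintro _ ⟨w, rfl⟩ a b; exact ⟨_, hup w a b⟩) y
    obtain ⟨w, rfl⟩ := this
    exact ⟨_, hg w⟩
  let m : Fin 2 → Fin 2 → (Module.End ℂ (Cq q))ᵐᵒᵖ := fun a b =>
    MulOpposite.op (cact q (tt q (e2 a) (e2 b)))
  have hc : ∀ y, ∃ x, y = rr q (up q x) := by
    intro y; obtain ⟨w, rfl⟩ := Submodule.mkQ_surjective _ y; exact rr_up_surj q hq w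
  have hm : ∀ i a j b w, (m i a * m j b).unop (rr q w) =
      rr q (w * (tt q (e2 i) (e2 a) * tt q (e2 j) (e2 b))) := by
    intro i a j b w
    rw [MulOpposite.unop_mul, Module.End.mul_apply]
    simp only [m, MulOpposite.unop_op]
    rw [cact_mk, cact_mk, mul_assoc]
  obtain ⟨Φ, hΦ⟩ := hh_lift q _ m (by
    intro i j
    apply MulOpposite.unop_injective
    refine LinearMap.ext fun y => ?_
    obtain ⟨x, rfl⟩ := hc y
    have e := congrArg (fun t => rr q (up q x * t)) (tt_eps_row q hq i j)
    simp only [Finset.mul_sum, mul_smul_comm, map_sum, map_smul, rr_up_dt q hq] at e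
    simp only [Finset.unop_sum, MulOpposite.unop_smul, LinearMap.sum_apply,
      LinearMap.smul_apply, hm]
    exact e) (by
    intro i j
    apply MulOpposite.unop_injective
    refine LinearMap.ext fun y => ?_
    obtain ⟨x, rfl⟩ := hc y
    have e := congrArg (fun t => rr q (up q x * t)) (tt_eps_col q hq i j)
    simp only [Finset.mul_sum, mul_smul_comm, map_sum, map_smul, rr_up_dt q hq] at e
    simp only [Finset.unop_sum, MulOpposite.unop_smul, LinearMap.sum_apply,
      LinearMap.smul_apply, hm]
    exact e)
  have hinv : ∀ x, (Φ (γ (up q x))).unop (rr q 1) = rr q (up q x) := by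
    intro x
    let L1 : FreeAlgebra ℂ (Fin 2 × Fin 2) →ₗ[ℂ] Cq q :=
     { toFun := fun x => (Φ (γ (up q x))).unop (rr q 1)
       map_add' := by intro x y; simp
       map_smul' := by intro c x; simp }
    have := free_gen (LinearMap.eqLocus L1 (rr q ∘ₗ (up q).toLinearMap)) ?_ ?_ x
    · exact this
    · change (Φ (γ (up q 1))).unop (rr q 1) = rr q (up q 1)
      rw [map_one (up q), hγ, map_one ρ]; simp
    · intro x hx p
      change (Φ (γ (up q x))).unop (rr q 1) = rr q (up q x) at hx
      change (Φ (γ (up q (x * _)))).unop (rr q 1) = rr q (up q (x * _))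
      rw [map_mul (up q), up_ι, hup, map_mul Φ, hΦ, MulOpposite.unop_mul, Module.End.mul_apply, hx]
      exact cact_mk q _ _
  have hinj : Function.Injective g := by
    rw [← LinearMap.ker_eq_bot, LinearMap.ker_eq_bot']
    intro y hy
    obtain ⟨x, rfl⟩ := hc y
    rw [hg] at hy
    rw [← hinv, hy]; simp
  exact ⟨ρ, LinearEquiv.ofBijective g ⟨hinj, hsurj⟩, hρ, hg⟩
end

/-! ### Part B4 -/

section
variable (q : ℝ)

/-- Inverse matrix, upper block. -/
def shu : Fin 2 → Fin 2 → HH q :=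
  ![![hh q 1 1, -((q : ℂ)⁻¹ • hh q 0 1)], ![-((q : ℂ) • hh q 1 0), hh q 0 0]]

/-- Inverse matrix, lower block. -/
def shn : Fin 2 → Fin 2 → HH q :=
  ![![hh q 0 0, (q : ℂ)⁻¹ • hh q 1 0], ![(q : ℂ) • hh q 0 1, hh q 1 1]]

/-- Inverse matrix acting on dual doublets, lower block. -/
def shl : Fin 2 → Fin 2 → HH q :=
  ![![hh q 1 1, -((q : ℂ) • hh q 0 1)], ![-((q : ℂ)⁻¹ • hh q 1 0), hh q 0 0]]

lemma shu_hh (hq : (q : ℂ) ≠ 0) (i j : Fin 2) : ∑ k, shu q i k * hh q k j = if i = j then 1 else 0 := by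
  fin_cases i <;> fin_cases j <;>
    simp [Fin.sum_univ_two, shu, -Complex.coe_smul, da q hq, bc q hq, bd q, ac q, ad' q, hq]

lemma hh_shu (hq : (q : ℂ) ≠ 0) (i j : Fin 2) : ∑ k, hh q i k * shu q k j = if i = j then 1 else 0 := by
  fin_cases i <;> fin_cases j <;>
    simp [Fin.sum_univ_two, shu, -Complex.coe_smul, da q hq, bc q hq, ab q, cd q, ad' q, hq]

lemma shl_hh (hq : (q : ℂ) ≠ 0) (i j : Fin 2) : ∑ k, shl q k j * hh q i k = if i = j then 1 else 0 := by
  fin_cases i <;> fin_cases j <;>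
    simp [Fin.sum_univ_two, shl, -Complex.coe_smul, da q hq, bc q hq, ab q, cd q, ad' q, hq]

lemma hl_shn (hq : (q : ℂ) ≠ 0) (i j : Fin 2) : ∑ k, hl q k j * shn q i k = if i = j then 1 else 0 := by
  fin_cases i <;> fin_cases j <;>
    simp [Fin.sum_univ_two, shn, hl, -Complex.coe_smul, da q hq, bc q hq, ac q, bd q, ad' q, hq]

/-- Upper antipode block. -/
def uS (i j : Fin 2) : (Module.End ℂ (HH q))ᵐᵒᵖ :=
  MulOpposite.op (LinearMap.mulRight ℂ (shu q i j))

/-- Lower antipode block. -/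
def lS (i j : Fin 2) : (Module.End ℂ (HH q))ᵐᵒᵖ :=
  MulOpposite.op (LinearMap.mulLeft ℂ (shn q i j))

lemma uS_uu (hq : (q : ℂ) ≠ 0) (i j : Fin 2) : ∑ k, uS q i k * uu q k j = if i = j then 1 else 0 := by
  apply MulOpposite.unop_injective
  refine LinearMap.ext fun x => ?_
  have := congrArg (x * ·) (shu_hh q hq i j)
  simp only [Finset.mul_sum, ← mul_assoc] at this
  simp only [Finset.unop_sum, LinearMap.sum_apply, uS, uu, MulOpposite.unop_mul,
    MulOpposite.unop_op, Module.End.mul_apply, LinearMap.mulRight_apply, this]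
  split_ifs <;> simp

lemma lS_ll (hq : (q : ℂ) ≠ 0) (i j : Fin 2) : ∑ k, lS q i k * ll q k j = if i = j then 1 else 0 := by
  apply MulOpposite.unop_injective
  refine LinearMap.ext fun x => ?_
  have := congrArg (· * x) (hl_shn q hq i j)
  simp only [Finset.sum_mul, mul_assoc] at this
  simp only [Finset.unop_sum, LinearMap.sum_apply, lS, ll, MulOpposite.unop_mul,
    MulOpposite.unop_op, Module.End.mul_apply, LinearMap.mulLeft_apply, this]
  split_ifs <;> simp

lemma rho_S (hq : (q : ℂ) ≠ 0) (ρ : AU q →ₐ[ℂ] (Module.End ℂ (HH q))ᵐᵒᵖ)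
    (hρ : ∀ i j, ρ (tt q i j) = blk (uu q) (ll q) i j) (S : AU q → AU q)
    (hSright : ∀ i j : Fin 4, ∑ k : Fin 4, tt q i k * S (tt q k j) = if i = j then 1 else 0)
    (i j : Fin 4) : ρ (S (tt q i j)) = blk (uS q) (lS q) i j := by
  let B : Matrix (Fin 4) (Fin 4) (Module.End ℂ (HH q))ᵐᵒᵖ := blk (uu q) (ll q)
  let N : Matrix (Fin 4) (Fin 4) (Module.End ℂ (HH q))ᵐᵒᵖ := blk (uS q) (lS q)
  let M : Matrix (Fin 4) (Fin 4) (Module.End ℂ (HH q))ᵐᵒᵖ := fun i j => ρ (S (tt q i j))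
  have h1 : B * M = 1 := by
    ext i j
    have := congrArg ρ (hSright i j)
    simp only [map_sum, map_mul, hρ] at this
    rw [Matrix.mul_apply]
    simp only [B, M]
    rw [this, Matrix.one_apply]; split_ifs <;> simp
  have h2 : N * B = 1 := by
    have u := uS_uu q hq
    have l := lS_ll q hq
    simp only [Fin.sum_univ_two] at u l
    ext i j
    rw [Matrix.mul_apply, Fin.sum_univ_four, Matrix.one_apply]
    fin_cases i <;> fin_cases j <;> simp [N, B, blk, u, l]
  have := left_inv_eq_right_inv h2 h1
  exact (congrFun (congrFun this i) j).symm

/-- The coaction transported to `H`. -/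
def DHm (δ : PA q →ₐ[ℂ] PA q ⊗[ℂ] AU q) (g : Cq q →ₗ[ℂ] HH q) : PA q →ₗ[ℂ] PA q ⊗[ℂ] HH q :=
  LinearMap.lTensor (PA q) g ∘ₗ Dr q δ

lemma DHm_mul (δ : PA q →ₐ[ℂ] PA q ⊗[ℂ] AU q) (g : Cq q →ₗ[ℂ] HH q)
    (ρ : AU q →ₐ[ℂ] (Module.End ℂ (HH q))ᵐᵒᵖ) (hg : ∀ w, g (rr q w) = (ρ w).unop 1)
    {x : PA q} (y : Fin 4 → PA q) (w : Fin 4 → AU q) (hx : δ x = ∑ j, y j ⊗ₜ[ℂ] w j) (p : PA q) :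
    DHm q δ g (p * x) = ∑ j, TensorProduct.map (LinearMap.mulRight ℂ (y j)) (ρ (w j)).unop
      (DHm q δ g p) := by
  simp only [DHm, Dr, LinearMap.comp_apply, AlgHom.toLinearMap_apply, map_mul, hx]
  generalize δ p = P
  induction P using TensorProduct.induction_on with
  | zero => simp
  | add a b ha hb => simp only [add_mul, map_add, ha, hb, Finset.sum_add_distrib]
  | tmul a b =>
    simp only [Finset.mul_sum, map_sum, Algebra.TensorProduct.tmul_mul_tmul,
      LinearMap.lTensor_tmul, hg, map_mul, TensorProduct.map_tmul, LinearMap.mulRight_apply]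
    rfl
end

/-! ### Part B5 -/

section
variable (q : ℝ)

/-- Upper doublets. -/
def vU : Fin 2 → Fin 2 → PA q := ![![z q 0, z q 1], ![zs q 1, -((q : ℂ) • zs q 0)]]
/-- Lower doublets. -/
def vL : Fin 2 → Fin 2 → PA q := ![![z q 3, -z q 2], ![zs q 2, (q : ℂ)⁻¹ • zs q 3]]
/-- Upper dual doublets. -/
def dU : Fin 2 → Fin 2 → PA q := ![![zs q 0, zs q 1], ![z q 1, -((q : ℂ) • z q 0)]]
/-- Lower dual doublets. -/
def dL : Fin 2 → Fin 2 → PA q := ![![zs q 3, -zs q 2], ![z q 2, (q : ℂ)⁻¹ • z q 3]]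

lemma PA_gen (hq : (q : ℂ) ≠ 0) (M : Submodule ℂ (PA q)) (h1 : 1 ∈ M)
    (hU : ∀ p ∈ M, ∀ k a, p * vU q k a ∈ M) (hL : ∀ p ∈ M, ∀ k a, p * vL q k a ∈ M) (p : PA q) :
    p ∈ M := by
  refine quot_gen _ M h1 ?_ p
  rintro x hx ⟨i, b⟩
  have hU := hU x hx
  have hL := hL x hx
  cases b with
  | false =>
    change x * z q i ∈ M
    fin_cases i
    · exact hU 0 0
    · exact hU 0 1
    · simpa [vL] using hL 0 1
    · exact hL 0 0
  | true =>
    change x * zs q i ∈ M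
    fin_cases i
    · have := M.smul_mem (-(q : ℂ)⁻¹) (hU 1 1)
      simpa [vU, hq, smul_smul, -Complex.coe_smul] using this
    · exact hU 1 0
    · exact hL 1 0
    · have := M.smul_mem ((q : ℂ)) (hL 1 1)
      simpa [vL, hq, smul_smul, -Complex.coe_smul] using this

variable {P H : Type} [Ring P] [Algebra ℂ P] [Ring H] [Algebra ℂ H]

lemma mulRight_smul' (c : ℂ) (y : P) :
    LinearMap.mulRight ℂ (c • y) = c • LinearMap.mulRight ℂ y := by ext; simp
lemma mulLeft_smul' (c : ℂ) (y : P) :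
    LinearMap.mulLeft ℂ (c • y) = c • LinearMap.mulLeft ℂ y := by ext; simp
lemma mulRight_neg' (y : P) :
    LinearMap.mulRight ℂ (-y) = (-1 : ℂ) • LinearMap.mulRight ℂ y := by ext; simp
lemma mulLeft_neg' (y : P) :
    LinearMap.mulLeft ℂ (-y) = (-1 : ℂ) • LinearMap.mulLeft ℂ y := by ext; simp

lemma map_neg_l {P' H' : Type} [AddCommGroup P'] [Module ℂ P'] [AddCommGroup H'] [Module ℂ H']
    (f : P' →ₗ[ℂ] P') (g : H' →ₗ[ℂ] H') :
    TensorProduct.map (-f) g = - TensorProduct.map f g := by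
  rw [← neg_one_smul ℂ f, TensorProduct.map_smul_left, neg_one_smul]
lemma map_neg_r {P' H' : Type} [AddCommGroup P'] [Module ℂ P'] [AddCommGroup H'] [Module ℂ H']
    (f : P' →ₗ[ℂ] P') (g : H' →ₗ[ℂ] H') :
    TensorProduct.map f (-g) = - TensorProduct.map f g := by
  rw [← neg_one_smul ℂ g, TensorProduct.map_smul_right, neg_one_smul]

lemma D_vU (hq : (q : ℂ) ≠ 0) (D : PA q →ₗ[ℂ] PA q ⊗[ℂ] HH q)
    (hz : ∀ p i, D (p * z q i) = ∑ j, TensorProduct.map (LinearMap.mulRight ℂ (z q j))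
      (blk (uu q) (ll q) j i).unop (D p))
    (hs : ∀ p i, D (p * zs q i) = ∑ j, TensorProduct.map (LinearMap.mulRight ℂ (zs q j))
      (blk (uS q) (lS q) i j).unop (D p)) (p : PA q) (k a : Fin 2) :
    D (p * vU q k a) = ∑ b, TensorProduct.map (LinearMap.mulRight ℂ (vU q k b))
      (LinearMap.mulRight ℂ (hh q b a)) (D p) := by
  fin_cases k <;> fin_cases a <;>
  simp [vU, hz, hs, Fin.sum_univ_four, Fin.sum_univ_two, blk, uu, ll, uS, lS, shu, -Complex.coe_smul,
    mulRight_smul', mulRight_neg', TensorProduct.map_smul_left, TensorProduct.map_smul_right, map_neg_l, map_neg_r,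
    smul_smul, hq]
  all_goals (match_scalars <;> field_simp)

lemma D_vL (hq : (q : ℂ) ≠ 0) (D : PA q →ₗ[ℂ] PA q ⊗[ℂ] HH q)
    (hz : ∀ p i, D (p * z q i) = ∑ j, TensorProduct.map (LinearMap.mulRight ℂ (z q j))
      (blk (uu q) (ll q) j i).unop (D p))
    (hs : ∀ p i, D (p * zs q i) = ∑ j, TensorProduct.map (LinearMap.mulRight ℂ (zs q j))
      (blk (uS q) (lS q) i j).unop (D p)) (p : PA q) (k a : Fin 2) :
    D (p * vL q k a) = ∑ b, TensorProduct.map (LinearMap.mulRight ℂ (vL q k b))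
      (LinearMap.mulLeft ℂ (hh q b a)) (D p) := by
  fin_cases k <;> fin_cases a <;>
  simp [vL, hz, hs, Fin.sum_univ_four, Fin.sum_univ_two, blk, uu, ll, uS, lS, shn, hl, -Complex.coe_smul,
    mulRight_smul', mulRight_neg', mulLeft_smul', mulLeft_neg',
    TensorProduct.map_smul_left, TensorProduct.map_smul_right, map_neg_l, map_neg_r,
    smul_smul, hq]
  all_goals (match_scalars <;> field_simp)

lemma D_dU (hq : (q : ℂ) ≠ 0) (D : PA q →ₗ[ℂ] PA q ⊗[ℂ] HH q)
    (hz : ∀ p i, D (p * z q i) = ∑ j, TensorProduct.map (LinearMap.mulRight ℂ (z q j))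
      (blk (uu q) (ll q) j i).unop (D p))
    (hs : ∀ p i, D (p * zs q i) = ∑ j, TensorProduct.map (LinearMap.mulRight ℂ (zs q j))
      (blk (uS q) (lS q) i j).unop (D p)) (p : PA q) (k a : Fin 2) :
    D (p * dU q k a) = ∑ b, TensorProduct.map (LinearMap.mulRight ℂ (dU q k b))
      (LinearMap.mulRight ℂ (shu q a b)) (D p) := by
  fin_cases k <;> fin_cases a <;>
  simp [dU, hz, hs, Fin.sum_univ_four, Fin.sum_univ_two, blk, uu, ll, uS, lS, shu, -Complex.coe_smul,
    mulRight_smul', mulRight_neg', TensorProduct.map_smul_left, TensorProduct.map_smul_right, map_neg_l, map_neg_r,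
    smul_smul, hq]
  all_goals (match_scalars <;> field_simp)

lemma D_dL (hq : (q : ℂ) ≠ 0) (D : PA q →ₗ[ℂ] PA q ⊗[ℂ] HH q)
    (hz : ∀ p i, D (p * z q i) = ∑ j, TensorProduct.map (LinearMap.mulRight ℂ (z q j))
      (blk (uu q) (ll q) j i).unop (D p))
    (hs : ∀ p i, D (p * zs q i) = ∑ j, TensorProduct.map (LinearMap.mulRight ℂ (zs q j))
      (blk (uS q) (lS q) i j).unop (D p)) (p : PA q) (k a : Fin 2) :
    D (p * dL q k a) = ∑ b, TensorProduct.map (LinearMap.mulRight ℂ (dL q k b))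
      (LinearMap.mulLeft ℂ (shl q a b)) (D p) := by
  fin_cases k <;> fin_cases a <;>
  simp [dL, hz, hs, Fin.sum_univ_four, Fin.sum_univ_two, blk, uu, ll, uS, lS, shn, shl, hl, -Complex.coe_smul,
    mulRight_smul', mulRight_neg', mulLeft_smul', mulLeft_neg',
    TensorProduct.map_smul_left, TensorProduct.map_smul_right, map_neg_l, map_neg_r,
    smul_smul, hq]
  all_goals (match_scalars <;> field_simp)
end

/-! ### Part C1 -/

section Sph
variable {P : Type} [Ring P] [Algebra ℂ P]

/-- The sphere relations, for elements of an arbitrary algebra. -/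
structure IsSph (q : ℂ) (x y : Fin 4 → P) : Prop where
  zz : ∀ i j, i < j → x j * x i = q⁻¹ • (x i * x j)
  ss : ∀ i j, i < j → y j * y i = q • (y i * y j)
  sz : ∀ i j, i ≠ j → y j * x i = q • (x i * y j)
  s0 : y 0 * x 0 = x 0 * y 0
  s1 : y 1 * x 1 = x 1 * y 1 + (1 - q ^ 2) • (x 0 * y 0)
  s2 : y 2 * x 2 = x 2 * y 2 + (1 - q ^ 2) • (x 0 * y 0) + (1 - q ^ 2) • (x 1 * y 1)
  s3 : y 3 * x 3 = x 3 * y 3 + (1 - q ^ 2) • (x 0 * y 0) + (1 - q ^ 2) • (x 1 * y 1)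
    + (1 - q ^ 2) • (x 2 * y 2)
  one : x 3 * y 3 = 1 - x 0 * y 0 - x 1 * y 1 - x 2 * y 2

/-- The upper radius. -/
def RR' (x y : Fin 4 → P) : P := x 0 * y 0 + x 1 * y 1

variable {q : ℂ} {x y : Fin 4 → P}

lemma IsSph.R_z0 (hq : q ≠ 0) (h : IsSph q x y) : RR' x y * x 0 = x 0 * RR' x y := by
  have e1 : y 1 * x 0 = q • (x 0 * y 1) := h.sz 0 1 (by decide)
  have e2 : x 1 * x 0 = q⁻¹ • (x 0 * x 1) := h.zz 0 1 (by decide)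
  simp only [RR', add_mul, mul_add, mul_assoc, h.s0, e1, mul_smul_comm]
  simp only [← mul_assoc, e2, smul_mul_assoc, smul_smul]
  rw [mul_inv_cancel₀ hq, one_smul]

lemma IsSph.R_z1 (hq : q ≠ 0) (h : IsSph q x y) : RR' x y * x 1 = x 1 * RR' x y := by
  have e1 : y 0 * x 1 = q • (x 1 * y 0) := h.sz 1 0 (by decide)
  have e2 : x 1 * x 0 = q⁻¹ • (x 0 * x 1) := h.zz 0 1 (by decide)
  simp only [RR', add_mul, mul_add, mul_assoc, h.s1, e1, mul_smul_comm]
  simp only [← mul_assoc, e2, smul_mul_assoc, smul_smul]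
  match_scalars <;> field_simp <;> ring

lemma IsSph.R_z2 (hq : q ≠ 0) (h : IsSph q x y) : RR' x y * x 2 = q ^ 2 • (x 2 * RR' x y) := by
  have e0 : y 0 * x 2 = q • (x 2 * y 0) := h.sz 2 0 (by decide)
  have e1 : y 1 * x 2 = q • (x 2 * y 1) := h.sz 2 1 (by decide)
  have e2 : x 2 * x 0 = q⁻¹ • (x 0 * x 2) := h.zz 0 2 (by decide)
  have e3 : x 2 * x 1 = q⁻¹ • (x 1 * x 2) := h.zz 1 2 (by decide)
  simp only [RR', add_mul, mul_add, mul_assoc, e0, e1, mul_smul_comm]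
  simp only [← mul_assoc, e2, e3, smul_mul_assoc, smul_smul]
  match_scalars <;> field_simp

lemma IsSph.R_z3 (hq : q ≠ 0) (h : IsSph q x y) : RR' x y * x 3 = q ^ 2 • (x 3 * RR' x y) := by
  have e0 : y 0 * x 3 = q • (x 3 * y 0) := h.sz 3 0 (by decide)
  have e1 : y 1 * x 3 = q • (x 3 * y 1) := h.sz 3 1 (by decide)
  have e2 : x 3 * x 0 = q⁻¹ • (x 0 * x 3) := h.zz 0 3 (by decide)
  have e3 : x 3 * x 1 = q⁻¹ • (x 1 * x 3) := h.zz 1 3 (by decide)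
  simp only [RR', add_mul, mul_add, mul_assoc, e0, e1, mul_smul_comm]
  simp only [← mul_assoc, e2, e3, smul_mul_assoc, smul_smul]
  match_scalars <;> field_simp

lemma IsSph.R_s0 (hq : q ≠ 0) (h : IsSph q x y) : RR' x y * y 0 = y 0 * RR' x y := by
  have e1 : y 0 * x 1 = q • (x 1 * y 0) := h.sz 1 0 (by decide)
  have e2 : y 1 * y 0 = q • (y 0 * y 1) := h.ss 0 1 (by decide)
  simp only [RR', add_mul, mul_add, ← mul_assoc, h.s0, e1, smul_mul_assoc]
  simp only [mul_assoc, e2, mul_smul_comm, smul_smul]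

lemma IsSph.R_s1 (hq : q ≠ 0) (h : IsSph q x y) : RR' x y * y 1 = y 1 * RR' x y := by
  have e1 : y 1 * x 0 = q • (x 0 * y 1) := h.sz 0 1 (by decide)
  have e2 : y 1 * y 0 = q • (y 0 * y 1) := h.ss 0 1 (by decide)
  simp only [RR', add_mul, mul_add, ← mul_assoc, h.s1, e1, smul_mul_assoc]
  simp only [mul_assoc, e2, mul_smul_comm, smul_smul]
  match_scalars <;> field_simp <;> ring

lemma IsSph.R_s2 (hq : q ≠ 0) (h : IsSph q x y) : RR' x y * y 2 = (q ^ 2)⁻¹ • (y 2 * RR' x y) := by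
  have e0 : y 2 * x 0 = q • (x 0 * y 2) := h.sz 0 2 (by decide)
  have e1 : y 2 * x 1 = q • (x 1 * y 2) := h.sz 1 2 (by decide)
  have e2 : y 2 * y 0 = q • (y 0 * y 2) := h.ss 0 2 (by decide)
  have e3 : y 2 * y 1 = q • (y 1 * y 2) := h.ss 1 2 (by decide)
  simp only [RR', add_mul, mul_add, ← mul_assoc, e0, e1, smul_mul_assoc]
  simp only [mul_assoc, e2, e3, mul_smul_comm, smul_smul]
  match_scalars <;> field_simp

lemma IsSph.R_s3 (hq : q ≠ 0) (h : IsSph q x y) : RR' x y * y 3 = (q ^ 2)⁻¹ • (y 3 * RR' x y) := by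
  have e0 : y 3 * x 0 = q • (x 0 * y 3) := h.sz 0 3 (by decide)
  have e1 : y 3 * x 1 = q • (x 1 * y 3) := h.sz 1 3 (by decide)
  have e2 : y 3 * y 0 = q • (y 0 * y 3) := h.ss 0 3 (by decide)
  have e3 : y 3 * y 1 = q • (y 1 * y 3) := h.ss 1 3 (by decide)
  simp only [RR', add_mul, mul_add, ← mul_assoc, e0, e1, smul_mul_assoc]
  simp only [mul_assoc, e2, e3, mul_smul_comm, smul_smul]
  match_scalars <;> field_simp

/-- Generic upper doublets. -/
def vU' (q : ℂ) (x y : Fin 4 → P) : Fin 2 → Fin 2 → P := ![![x 0, x 1], ![y 1, -(q • y 0)]]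
/-- Generic lower doublets. -/
def vL' (q : ℂ) (x y : Fin 4 → P) : Fin 2 → Fin 2 → P := ![![x 3, -x 2], ![y 2, q⁻¹ • y 3]]
/-- Generic upper dual doublets. -/
def dU' (q : ℂ) (x y : Fin 4 → P) : Fin 2 → Fin 2 → P := ![![y 0, y 1], ![x 1, -(q • x 0)]]
/-- Generic lower dual doublets. -/
def dL' (q : ℂ) (x y : Fin 4 → P) : Fin 2 → Fin 2 → P := ![![y 3, -y 2], ![x 2, q⁻¹ • x 3]]

end Sph

/-! ### Part C2 -/

section SphU
variable {P : Type} [Ring P] [Algebra ℂ P] {q : ℂ} {x y : Fin 4 → P}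

/-- The matrix `ε`. -/
def epU (q : ℂ) : Fin 2 → Fin 2 → ℂ := ![![0, 1], ![-q, 0]]
/-- Constants for the upper chart. -/
def lamU (q : ℂ) : Fin 2 → ℂ := ![-q⁻¹, (q ^ 2)⁻¹]
/-- Constants for the upper chart. -/
def muU (q : ℂ) : Fin 2 → ℂ := ![-q ^ 3, q ^ 2]
/-- Constants for the upper chart. -/
def kapU (q : ℂ) : Fin 2 → Fin 2 → ℂ := ![![q⁻¹, q⁻¹], ![q, q]]
/-- Constants for the upper chart. -/
def dcU (q : ℂ) : Fin 2 → ℂ := ![q ^ 2, (q ^ 2)⁻¹]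
/-- Constants for the upper chart. -/
def tU (q : ℂ) : Fin 2 → ℂ := ![(q ^ 2)⁻¹, q ^ 2]
/-- Duals for the upper chart. -/
def wU (q : ℂ) (x y : Fin 4 → P) (k a : Fin 2) : P := q ^ 2 • dU' q x y k a

lemma IsSph.U_Rv (hq : q ≠ 0) (h : IsSph q x y) (k a : Fin 2) :
    RR' x y * vU' q x y k a = vU' q x y k a * RR' x y := by
  fin_cases k <;> fin_cases a <;>
    simp [vU', h.R_z0 hq, h.R_z1 hq, h.R_s0 hq, h.R_s1 hq]

lemma IsSph.U_Rvs (hq : q ≠ 0) (h : IsSph q x y) (k a : Fin 2) :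
    RR' x y * wU q x y k a = wU q x y k a * RR' x y := by
  fin_cases k <;> fin_cases a <;>
    simp [wU, dU', h.R_z0 hq, h.R_z1 hq, h.R_s0 hq, h.R_s1 hq]

lemma IsSph.U_Ro (hq : q ≠ 0) (h : IsSph q x y) (k a : Fin 2) :
    RR' x y * vL' q x y k a = dcU q k • (vL' q x y k a * RR' x y) := by
  fin_cases k <;> fin_cases a <;>
    simp [vL', dcU, h.R_z2 hq, h.R_z3 hq, h.R_s2 hq, h.R_s3 hq, smul_smul]
  match_scalars <;> field_simp

lemma IsSph.U_vs_v (hq : q ≠ 0) (h : IsSph q x y) (a b : Fin 2) :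
    ∑ k, wU q x y k a * vU' q x y k b = if a = b then q ^ 2 • RR' x y else 0 := by
  fin_cases a <;> fin_cases b <;>
    simp [vU', wU, dU', RR', h.s0, h.s1, h.ss 0 1, h.zz 0 1, h.sz 0 1, h.sz 1 0, smul_smul, Fin.sum_univ_two]
  all_goals (match_scalars <;> field_simp <;> ring)

lemma IsSph.U_v_vs (hq : q ≠ 0) (h : IsSph q x y) (k l : Fin 2) :
    ∑ a, vU' q x y k a * wU q x y l a = if k = l then q ^ 2 • RR' x y else 0 := by
  fin_cases k <;> fin_cases l <;>
    simp [vU', wU, dU', RR', h.s0, h.s1, h.ss 0 1, h.zz 0 1, h.sz 0 1, h.sz 1 0, smul_smul, Fin.sum_univ_two]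
  all_goals (match_scalars <;> field_simp <;> ring)

lemma IsSph.U_rowv (hq : q ≠ 0) (h : IsSph q x y) (k l : Fin 2) :
    ∑ a, ∑ b, epU q a b • (vU' q x y k a * vU' q x y l b)
      = if k = l then 0 else lamU q k • q ^ 2 • RR' x y := by
  fin_cases k <;> fin_cases l <;>
    simp [vU', epU, lamU, RR', h.s0, h.s1, h.ss 0 1, h.zz 0 1, h.sz 0 1, h.sz 1 0, smul_smul, Fin.sum_univ_two]
  all_goals (match_scalars <;> field_simp <;> ring)

lemma IsSph.U_rowvs (hq : q ≠ 0) (h : IsSph q x y) (i j : Fin 2) :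
    lamU q 0 • (wU q x y 1 j * wU q x y 0 i) + lamU q 1 • (wU q x y 0 j * wU q x y 1 i)
      = epU q i j • q ^ 2 • RR' x y := by
  fin_cases i <;> fin_cases j <;>
    simp [wU, dU', epU, lamU, RR', h.s0, h.s1, h.ss 0 1, h.zz 0 1, h.sz 0 1, h.sz 1 0, smul_smul, Fin.sum_univ_two]
  all_goals (match_scalars <;> field_simp <;> ring)

lemma IsSph.U_colvs (hq : q ≠ 0) (h : IsSph q x y) (k l : Fin 2) :
    ∑ i, ∑ j, epU q i j • (wU q x y l j * wU q x y k i)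
      = if k = l then 0 else muU q k • q ^ 2 • RR' x y := by
  fin_cases k <;> fin_cases l <;>
    simp [wU, dU', epU, muU, RR', h.s0, h.s1, h.ss 0 1, h.zz 0 1, h.sz 0 1, h.sz 1 0, smul_smul, Fin.sum_univ_two]
  all_goals (match_scalars <;> field_simp <;> ring)

lemma IsSph.U_colv (hq : q ≠ 0) (h : IsSph q x y) (a b : Fin 2) :
    muU q 0 • (vU' q x y 0 a * vU' q x y 1 b) + muU q 1 • (vU' q x y 1 a * vU' q x y 0 b)
      = epU q a b • q ^ 2 • RR' x y := by
  fin_cases a <;> fin_cases b <;>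
    simp [vU', epU, muU, RR', h.s0, h.s1, h.ss 0 1, h.zz 0 1, h.sz 0 1, h.sz 1 0, smul_smul, Fin.sum_univ_two]
  all_goals (match_scalars <;> field_simp <;> ring)

lemma IsSph.U_o_vs (hq : q ≠ 0) (h : IsSph q x y) (k l a b : Fin 2) :
    vL' q x y k a * wU q x y l b = kapU q k l • (wU q x y l b * vL' q x y k a) := by
  fin_cases k <;> fin_cases l <;> fin_cases a <;> fin_cases b <;>
    simp [vL', wU, dU', kapU, h.sz, h.ss 0 2, h.ss 0 3, h.ss 1 2, h.ss 1 3, h.zz 0 2,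
      h.zz 0 3, h.zz 1 2, h.zz 1 3, smul_smul]
  all_goals (match_scalars <;> field_simp)

lemma IsSph.U_o_v (hq : q ≠ 0) (h : IsSph q x y) (k l a b : Fin 2) :
    kapU q k l • (vL' q x y k a * vU' q x y l b) = tU q k • (vU' q x y l b * vL' q x y k a) := by
  fin_cases k <;> fin_cases l <;> fin_cases a <;> fin_cases b <;>
    simp [vL', vU', kapU, tU, h.sz, h.ss 0 2, h.ss 0 3, h.ss 1 2, h.ss 1 3, h.zz 0 2,
      h.zz 0 3, h.zz 1 2, h.zz 1 3, smul_smul]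
  all_goals (match_scalars <;> field_simp)
end SphU

/-! ### Part C3 -/

section SphL
variable {P : Type} [Ring P] [Algebra ℂ P] {q : ℂ} {x y : Fin 4 → P}

/-- The transposed matrix `ε`. -/
def epL (q : ℂ) : Fin 2 → Fin 2 → ℂ := ![![0, -q], ![1, 0]]
/-- Constants for the lower chart. -/
def lamL (q : ℂ) : Fin 2 → ℂ := ![-1, q⁻¹]
/-- Constants for the lower chart. -/
def muL (q : ℂ) : Fin 2 → ℂ := ![-q ^ 2, q]
/-- Constants for the lower chart. -/
def kapL (q : ℂ) : Fin 2 → Fin 2 → ℂ := ![![q⁻¹, q], ![q⁻¹, q]]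
/-- Constants for the lower chart. -/
def cL (q : ℂ) : Fin 2 → ℂ := ![(q ^ 2)⁻¹, q ^ 2]
/-- Duals for the lower chart. -/
def wL (q : ℂ) (x y : Fin 4 → P) (k a : Fin 2) : P := (![1, q ^ 2] : Fin 2 → ℂ) k • dL' q x y k a
/-- The element `1 - q² c R`. -/
def gL (q : ℂ) (x y : Fin 4 → P) (c : ℂ) : P := 1 - (q ^ 2 * c) • RR' x y

lemma IsSph.L_Rv (hq : q ≠ 0) (h : IsSph q x y) (k a : Fin 2) :
    RR' x y * vL' q x y k a = cL q (k + 1) • (vL' q x y k a * RR' x y) := by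
  fin_cases k <;> fin_cases a <;>
    simp [vL', cL, h.R_z2 hq, h.R_z3 hq, h.R_s2 hq, h.R_s3 hq, smul_smul]
  match_scalars <;> field_simp

lemma IsSph.L_Rvs (hq : q ≠ 0) (h : IsSph q x y) (k a : Fin 2) :
    RR' x y * wL q x y k a = cL q k • (wL q x y k a * RR' x y) := by
  fin_cases k <;> fin_cases a <;>
    simp [wL, dL', cL, h.R_z2 hq, h.R_z3 hq, h.R_s2 hq, h.R_s3 hq, smul_smul]
  all_goals (match_scalars <;> field_simp)

lemma IsSph.L_vs_v (hq : q ≠ 0) (h : IsSph q x y) (a b : Fin 2) :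
    ∑ k, wL q x y k a * vL' q x y k b = if a = b then gL q x y 1 else 0 := by
  fin_cases a <;> fin_cases b <;>
    simp [vL', wL, dL', gL, RR', h.s2, h.s3, h.one, h.ss 2 3, h.zz 2 3, h.sz 2 3, h.sz 3 2, smul_smul, Fin.sum_univ_two]
  all_goals (match_scalars <;> field_simp <;> ring)

lemma IsSph.L_v_vs (hq : q ≠ 0) (h : IsSph q x y) (k l : Fin 2) :
    ∑ a, vL' q x y k a * wL q x y l a = if k = l then gL q x y (cL q k) else 0 := by
  fin_cases k <;> fin_cases l <;>
    simp [vL', wL, dL', gL, cL, RR', h.s2, h.s3, h.one, h.ss 2 3, h.zz 2 3, h.sz 2 3, h.sz 3 2, smul_smul, Fin.sum_univ_two, hq]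
  all_goals (match_scalars <;> field_simp <;> ring)

lemma IsSph.L_rowv (hq : q ≠ 0) (h : IsSph q x y) (k l : Fin 2) :
    ∑ a, ∑ b, epL q a b • (vL' q x y k a * vL' q x y l b)
      = if k = l then 0 else lamL q k • gL q x y (cL q k) := by
  fin_cases k <;> fin_cases l <;>
    simp [vL', epL, lamL, gL, cL, RR', h.s2, h.s3, h.one, h.ss 2 3, h.zz 2 3, h.sz 2 3, h.sz 3 2, smul_smul, Fin.sum_univ_two, hq]
  all_goals (match_scalars <;> (try field_simp) <;> ring)

lemma IsSph.L_rowvs (hq : q ≠ 0) (h : IsSph q x y) (i j : Fin 2) :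
    lamL q 0 • (wL q x y 1 j * wL q x y 0 i) + lamL q 1 • (wL q x y 0 j * wL q x y 1 i)
      = epL q i j • gL q x y 1 := by
  fin_cases i <;> fin_cases j <;>
    simp [wL, dL', epL, lamL, gL, RR', h.s2, h.s3, h.one, h.ss 2 3, h.zz 2 3, h.sz 2 3, h.sz 3 2, smul_smul, Fin.sum_univ_two]
  all_goals (match_scalars <;> field_simp <;> ring)

lemma IsSph.L_colvs (hq : q ≠ 0) (h : IsSph q x y) (k l : Fin 2) :
    ∑ i, ∑ j, epL q i j • (wL q x y l j * wL q x y k i)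
      = if k = l then 0 else muL q k • gL q x y (cL q k) := by
  fin_cases k <;> fin_cases l <;>
    simp [wL, dL', epL, muL, gL, cL, RR', h.s2, h.s3, h.one, h.ss 2 3, h.zz 2 3, h.sz 2 3, h.sz 3 2, smul_smul, Fin.sum_univ_two, hq]
  all_goals (match_scalars <;> field_simp <;> ring)

lemma IsSph.L_colv (hq : q ≠ 0) (h : IsSph q x y) (a b : Fin 2) :
    muL q 0 • (vL' q x y 0 a * vL' q x y 1 b) + muL q 1 • (vL' q x y 1 a * vL' q x y 0 b)
      = epL q a b • gL q x y 1 := by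
  fin_cases a <;> fin_cases b <;>
    simp [vL', epL, muL, gL, RR', h.s2, h.s3, h.one, h.ss 2 3, h.zz 2 3, h.sz 2 3, h.sz 3 2, smul_smul, Fin.sum_univ_two]
  all_goals (match_scalars <;> field_simp <;> ring)

lemma IsSph.L_o_vs (hq : q ≠ 0) (h : IsSph q x y) (k l a b : Fin 2) :
    vU' q x y k a * wL q x y l b = kapL q k l • (wL q x y l b * vU' q x y k a) := by
  fin_cases k <;> fin_cases l <;> fin_cases a <;> fin_cases b <;>
    simp [vU', wL, dL', kapL, h.sz, h.ss 0 2, h.ss 0 3, h.ss 1 2, h.ss 1 3, h.zz 0 2,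
      h.zz 0 3, h.zz 1 2, h.zz 1 3, smul_smul]
  all_goals (match_scalars <;> field_simp)

lemma IsSph.L_o_v (hq : q ≠ 0) (h : IsSph q x y) (k l a b : Fin 2) :
    kapL q k l • (vU' q x y k a * vL' q x y l b) = (vL' q x y l b * vU' q x y k a) := by
  fin_cases k <;> fin_cases l <;> fin_cases a <;> fin_cases b <;>
    simp [vL', vU', kapL, h.sz, h.ss 0 2, h.ss 0 3, h.ss 1 2, h.ss 1 3, h.zz 0 2,
      h.zz 0 3, h.zz 1 2, h.zz 1 3, smul_smul]
  all_goals (match_scalars <;> field_simp)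
end SphL

/-! ### Part C4 -/

section
variable (q : ℝ)

lemma PA_sph (hq : (q : ℂ) ≠ 0) : IsSph (q : ℂ) (z q) (zs q) := by
  have zz : ∀ i j, i < j → z q i * z q j = (q : ℂ) • (z q j * z q i) := fun i j h => by
    have := RingQuot.mkAlgHom_rel ℂ (relS.zz (q := q) h)
    simp only [map_mul, map_smul] at this
    exact this
  have ss : ∀ i j, i < j → zs q j * zs q i = (q : ℂ) • (zs q i * zs q j) := fun i j h => by
    have := RingQuot.mkAlgHom_rel ℂ (relS.ss (q := q) h)
    simp only [map_mul, map_smul] at this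
    exact this
  have sz : ∀ i j, i ≠ j → zs q j * z q i = (q : ℂ) • (z q i * zs q j) := fun i j h => by
    have := RingQuot.mkAlgHom_rel ℂ (relS.sz (q := q) h)
    simp only [map_mul, map_smul] at this
    exact this
  have szz : ∀ k, zs q k * z q k = z q k * zs q k + (1 - (q : ℂ) ^ 2) •
        ∑ j ∈ Finset.univ.filter (· < k), z q j * zs q j := fun k => by
    have := RingQuot.mkAlgHom_rel ℂ (relS.szz (q := q) (k := k))
    simp only [map_mul, map_smul, map_add, map_sum] at this
    exact this
  have one : ∑ k, z q k * zs q k = 1 := by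
    have := RingQuot.mkAlgHom_rel ℂ (relS.sum1 (q := q))
    simp only [map_mul, map_one, map_sum] at this
    exact this
  have f0 : (Finset.univ.filter (· < (0 : Fin 4))) = ∅ := by decide
  have f1 : (Finset.univ.filter (· < (1 : Fin 4))) = {0} := by decide
  have f2 : (Finset.univ.filter (· < (2 : Fin 4))) = {0, 1} := by decide
  have f3 : (Finset.univ.filter (· < (3 : Fin 4))) = {0, 1, 2} := by decide
  refine ⟨fun i j h => ?_, ss, sz, ?_, ?_, ?_, ?_, ?_⟩
  · rw [zz i j h, smul_smul, inv_mul_cancel₀ hq, one_smul]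
  · rw [szz 0, f0, Finset.sum_empty, smul_zero, add_zero]
  · rw [szz 1, f1, Finset.sum_singleton]
  · rw [szz 2, f2, Finset.sum_insert (by decide), Finset.sum_singleton]; module
  · rw [szz 3, f3, Finset.sum_insert (by decide), Finset.sum_insert (by decide),
      Finset.sum_singleton]; module
  · rw [← one, Fin.sum_univ_four]; abel

lemma vU_eq : vU q = vU' (q : ℂ) (z q) (zs q) := rfl
lemma vL_eq : vL q = vL' (q : ℂ) (z q) (zs q) := rfl
lemma dU_eq : dU q = dU' (q : ℂ) (z q) (zs q) := rfl
lemma dL_eq : dL q = dL' (q : ℂ) (z q) (zs q) := rfl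

/-- The radius in `PA q`. -/
abbrev RP : PA q := RR' (z q) (zs q)

open Polynomial in
lemma aeval_sc {P : Type} [Ring P] [Algebra ℂ P] (R : P) (c α β : ℂ) :
    aeval R (sc c (C α + C β * X)) = α • (1 : P) + (β * c) • R := by
  simp [sc, Algebra.algebraMap_eq_smul_one, smul_smul]
  rw [mul_comm]

open Polynomial in
lemma aeval_lin {P : Type} [Ring P] [Algebra ℂ P] (R : P) (α β : ℂ) :
    aeval R (C α + C β * X) = α • (1 : P) + β • R := by
  simp [Algebra.algebraMap_eq_smul_one]

open Polynomial in
/-- Divisors of powers of `X`. -/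
def SU : Submonoid ℂ[X] where
  carrier := {p | ∃ n : ℕ, p ∣ X ^ n}
  one_mem' := ⟨0, by simp⟩
  mul_mem' := by
    rintro a b ⟨n, hn⟩ ⟨m, hm⟩
    exact ⟨n + m, by rw [pow_add]; exact mul_dvd_mul hn hm⟩

open Polynomial in
lemma SU_sc (s : ℂ[X]) (hs : s ∈ SU) (c : ℂ) (hc : c ≠ 0) : sc c s ∈ SU := by
  obtain ⟨n, hn⟩ := hs
  refine ⟨n, (map_dvd (sc c) hn).trans ?_⟩
  refine ⟨C ((c ^ n)⁻¹), ?_⟩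
  rw [map_pow, sc, aeval_X, mul_pow, ← C_pow]
  rw [mul_right_comm, ← C_mul, mul_inv_cancel₀ (pow_ne_zero n hc), C_1, one_mul]

open Polynomial in
/-- Polynomials that do not vanish at zero. -/
def SL : Submonoid ℂ[X] where
  carrier := {p | p.eval 0 ≠ 0}
  one_mem' := by simp
  mul_mem' := by
    intro a b ha hb
    simpa using ⟨ha, hb⟩

open Polynomial in
lemma SL_sc (s : ℂ[X]) (hs : s ∈ SL) (c : ℂ) (hc : c ≠ 0) : sc c s ∈ SL := by
  change (sc c s).eval 0 ≠ 0
  have : (sc c s).eval 0 = s.eval 0 := by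
    have h := Polynomial.eval_comp (p := s) (q := C c * X) (x := 0)
    rw [show sc c s = s.comp (C c * X) from rfl, h]; simp
  rw [this]; exact hs

open Polynomial in
lemma SU_SL (s t : ℂ[X]) (hs : s ∈ SU) (ht : t ∈ SL) : IsCoprime s t := by
  obtain ⟨n, hn⟩ := hs
  refine IsCoprime.of_isCoprime_of_dvd_left ?_ hn
  refine IsCoprime.pow_left ?_
  rw [Irreducible.coprime_iff_not_dvd irreducible_X, X_dvd_iff, coeff_zero_eq_eval_zero]
  exact ht

lemma hh_gen_left (M : Submodule ℂ (HH q)) (h1 : 1 ∈ M)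
    (hm : ∀ x ∈ M, ∀ a b, hh q a b * x ∈ M) (x : HH q) : x ∈ M := by
  let N : Submodule ℂ (HH q) :=
    { carrier := {x | ∀ y ∈ M, x * y ∈ M}
      add_mem' := fun {a b} ha hb y hy => by rw [add_mul]; exact M.add_mem (ha y hy) (hb y hy)
      zero_mem' := fun y hy => by rw [zero_mul]; exact M.zero_mem
      smul_mem' := fun c a ha y hy => by rw [smul_mul_assoc]; exact M.smul_mem c (ha y hy) }
  have : x ∈ N := hh_gen q N (fun y hy => by rwa [one_mul])
    (fun a ha i j y hy => by rw [mul_assoc]; exact ha _ (hm y hy i j)) x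
  simpa using this 1 h1

lemma hhop_lift (E : Type) [Ring E] [Algebra ℂ E] (m : Fin 2 → Fin 2 → E)
    (hr : ∀ i j, ∑ a, ∑ b, epL (q : ℂ) a b • (m i a * m j b) = epL (q : ℂ) i j • 1)
    (hc : ∀ a b, ∑ i, ∑ j, epL (q : ℂ) i j • (m i a * m j b) = epL (q : ℂ) a b • 1) :
    ∃ Φ : (HH q)ᵐᵒᵖ →ₐ[ℂ] E, ∀ a b, Φ (MulOpposite.op (hh q a b)) = m a b := by
  have ht : ∀ i j, epL (q : ℂ) i j = eps q j i := by
    intro i j; fin_cases i <;> fin_cases j <;> rfl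
  obtain ⟨Φ, hΦ⟩ := hh_lift q Eᵐᵒᵖ (fun i j => MulOpposite.op (m i j))
    (fun i j => by
      have := congrArg MulOpposite.op (hr j i)
      rw [Finset.sum_comm] at this
      simpa only [ht, Finset.op_sum, MulOpposite.op_smul, MulOpposite.op_mul,
        MulOpposite.op_one] using this)
    (fun i j => by
      have := congrArg MulOpposite.op (hc j i)
      rw [Finset.sum_comm] at this
      simpa only [ht, Finset.op_sum, MulOpposite.op_smul, MulOpposite.op_mul,
        MulOpposite.op_one] using this)
  refine ⟨(AlgEquiv.opOp ℂ E).symm.toAlgHom.comp (AlgHom.op Φ), fun a b => ?_⟩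
  simp [hΦ]
end

/-! ### Part C5 -/

section
open Polynomial

/-- The bimodule data feeding both charts. -/
structure Bim (q : ℝ) (W : Type) [AddCommGroup W] [Module ℂ W] [Module ℂ[X] W] where
  lm : PA q →ₐ[ℂ] Module.End ℂ W
  rm : PA q →ₗ[ℂ] Module.End ℂ W
  rm_one : rm 1 = 1
  rm_mul : ∀ a b w, rm (a * b) w = rm b (rm a w)
  lr : ∀ a b w, lm a (rm b w) = rm b (lm a w)
  e : W
  D : PA q →ₗ[ℂ] PA q ⊗[ℂ] HH q
  D_one : D 1 = 1 ⊗ₜ 1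
  coinv : ∀ b, D b = b ⊗ₜ 1 → lm b e = rm b e
  chi : W →ₗ[ℂ] PA q ⊗[ℂ] HH q
  chi_eq : ∀ p' p, chi (lm p' (rm p e)) =
    TensorProduct.map (LinearMap.mulLeft ℂ p') LinearMap.id (D p)
  span : ∀ w : W, w ∈ Submodule.span ℂ (Set.range fun x : PA q × PA q => lm x.1 (rm x.2 e))
  X_smul : ∀ w : W, (X : ℂ[X]) • w = rm (RP q) w
  hz : ∀ p i, D (p * z q i) = ∑ j, TensorProduct.map (LinearMap.mulRight ℂ (z q j))
      (blk (uu q) (ll q) j i).unop (D p)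
  hs : ∀ p i, D (p * zs q i) = ∑ j, TensorProduct.map (LinearMap.mulRight ℂ (zs q j))
      (blk (uS q) (lS q) i j).unop (D p)

variable {q : ℝ} {W : Type} [AddCommGroup W] [Module ℂ W] [Module ℂ[X] W] (Y : Bim q W)

namespace Bim

lemma D_vU1 (hq : (q : ℂ) ≠ 0) (k a : Fin 2) :
    Y.D (vU q k a) = ∑ b, vU q k b ⊗ₜ[ℂ] hh q b a := by
  have := D_vU q hq Y.D Y.hz Y.hs 1 k a
  simpa only [one_mul, Y.D_one, TensorProduct.map_tmul, LinearMap.mulRight_apply] using this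

lemma D_vL1 (hq : (q : ℂ) ≠ 0) (k a : Fin 2) :
    Y.D (vL q k a) = ∑ b, vL q k b ⊗ₜ[ℂ] hh q b a := by
  have := D_vL q hq Y.D Y.hz Y.hs 1 k a
  simpa only [one_mul, mul_one, Y.D_one, TensorProduct.map_tmul, LinearMap.mulRight_apply,
    LinearMap.mulLeft_apply] using this

lemma coU (hq : (q : ℂ) ≠ 0) (u : Fin 2 → PA q) (hu : ∀ a, Y.D (u a) = ∑ b, u b ⊗ₜ[ℂ] hh q b a)
    (l : Fin 2) : Y.D (∑ b, u b * dU q l b) = (∑ b, u b * dU q l b) ⊗ₜ[ℂ] 1 := by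
  have e1 : ∀ b, Y.D (u b * dU q l b) =
      ∑ c, ∑ e, (u e * dU q l c) ⊗ₜ[ℂ] (hh q e b * shu q b c) := fun b => by
    rw [D_dU q hq Y.D Y.hz Y.hs (u b) l b]
    simp only [hu, map_sum, TensorProduct.map_tmul, LinearMap.mulRight_apply]
  rw [map_sum, Finset.sum_congr rfl fun b _ => e1 b, Finset.sum_comm,
    TensorProduct.sum_tmul]
  refine Finset.sum_congr rfl fun c _ => ?_
  rw [Finset.sum_comm]
  simp only [← TensorProduct.tmul_sum, hh_shu q hq]
  rw [Finset.sum_eq_single c]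
  · rw [if_pos rfl]
  · intro b _ hb; rw [if_neg hb, TensorProduct.tmul_zero]
  · intro h; exact absurd (Finset.mem_univ c) h

lemma coL (hq : (q : ℂ) ≠ 0) (u : Fin 2 → PA q) (hu : ∀ a, Y.D (u a) = ∑ b, u b ⊗ₜ[ℂ] hh q b a)
    (l : Fin 2) : Y.D (∑ b, u b * dL q l b) = (∑ b, u b * dL q l b) ⊗ₜ[ℂ] 1 := by
  have e1 : ∀ b, Y.D (u b * dL q l b) =
      ∑ c, ∑ e, (u e * dL q l c) ⊗ₜ[ℂ] (shl q b c * hh q e b) := fun b => by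
    rw [D_dL q hq Y.D Y.hz Y.hs (u b) l b]
    simp only [hu, map_sum, TensorProduct.map_tmul, LinearMap.mulRight_apply,
      LinearMap.mulLeft_apply]
  rw [map_sum, Finset.sum_congr rfl fun b _ => e1 b, Finset.sum_comm,
    TensorProduct.sum_tmul]
  refine Finset.sum_congr rfl fun c _ => ?_
  rw [Finset.sum_comm]
  simp only [← TensorProduct.tmul_sum, shl_hh q hq]
  rw [Finset.sum_eq_single c]
  · rw [if_pos rfl]
  · intro b _ hb; rw [if_neg hb, TensorProduct.tmul_zero]
  · intro h; exact absurd (Finset.mem_univ c) h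

lemma hR (hq : (q : ℂ) ≠ 0) : Y.lm (RP q) Y.e = Y.rm (RP q) Y.e := by
  apply Y.coinv
  have := Y.coU hq (vU q 0) (Y.D_vU1 hq 0) 0
  rw [Fin.sum_univ_two] at this
  exact this

/-- The upper chart. -/
def chartU (hq : (q : ℂ) ≠ 0) : Chart (PA q) W (HH q) where
  lm := Y.lm
  rm := Y.rm
  rm_one := Y.rm_one
  rm_mul := Y.rm_mul
  lr := Y.lr
  e := Y.e
  D := Y.D
  D_one := Y.D_one
  coinv := Y.coinv
  chi := Y.chi
  chi_eq := Y.chi_eq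
  span := Y.span
  R := RP q
  X_smul := Y.X_smul
  v := vU q
  vs := wU (q : ℂ) (z q) (zs q)
  o := vL q
  gen := fun M h1 hv ho p => PA_gen q hq M h1 hv ho p
  h := hh q
  hgen := hh_gen q
  eps := epU (q : ℂ)
  lift := fun E _ _ m hr hc => hh_lift q E m hr hc
  c := fun _ => 1
  cc := one_mul 1
  d := dcU (q : ℂ)
  d_ne := by intro k; fin_cases k <;> simp [dcU] <;> simpa using hq
  g := C 0 + C ((q : ℂ) ^ 2) * X
  S := SU
  g_mem := ⟨1, C (((q : ℂ) ^ 2)⁻¹), by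
    rw [C_0, zero_add, mul_right_comm, ← C_mul, mul_inv_cancel₀ (pow_ne_zero 2 hq), C_1, one_mul,
      pow_one]⟩
  S_sc := SU_sc
  lam := lamU (q : ℂ)
  mu := muU (q : ℂ)
  kap := kapU (q : ℂ)
  t := tU (q : ℂ)
  Dv := D_vU q hq Y.D Y.hz Y.hs
  Do := D_vL q hq Y.D Y.hz Y.hs
  Rv := fun k a => by rw [one_smul]; exact (PA_sph q hq).U_Rv hq k a
  Rvs := fun k a => by rw [one_smul]; exact (PA_sph q hq).U_Rvs hq k a
  Ro := fun k a => (PA_sph q hq).U_Ro hq k a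
  vs_v := fun a b => by
    rw [aeval_lin, zero_smul, zero_add]; exact (PA_sph q hq).U_vs_v hq a b
  v_vs := fun a b => by
    rw [aeval_sc, zero_smul, zero_add, mul_one]; exact (PA_sph q hq).U_v_vs hq a b
  rowv := fun a b => by
    rw [aeval_sc, zero_smul, zero_add, mul_one]; exact (PA_sph q hq).U_rowv hq a b
  rowvs := fun a b => by
    rw [aeval_lin, zero_smul, zero_add]; exact (PA_sph q hq).U_rowvs hq a b
  colvs := fun a b => by
    rw [aeval_sc, zero_smul, zero_add, mul_one]; exact (PA_sph q hq).U_colvs hq a b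
  colv := fun a b => by
    rw [aeval_lin, zero_smul, zero_add]; exact (PA_sph q hq).U_colv hq a b
  o_vs := fun k l a b => (PA_sph q hq).U_o_vs hq k l a b
  o_v := fun k l a b => (PA_sph q hq).U_o_v hq k l a b
  t_g := fun k => by
    have : tU (q : ℂ) k * dcU (q : ℂ) k = 1 := by
      fin_cases k
      · exact inv_mul_cancel₀ (pow_ne_zero 2 hq)
      · exact mul_inv_cancel₀ (pow_ne_zero 2 hq)
    rw [C_0, zero_add, map_mul, sc, aeval_X, aeval_C, ← Polynomial.C_eq_algebraMap, ← smul_eq_C_mul, ← smul_eq_C_mul,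
      smul_comm, smul_smul (tU (q : ℂ) k), this, one_smul, smul_eq_C_mul]
  b_coinv := fun k l => by
    have h := congrArg (fun x => (q : ℂ) ^ 2 • x) (Y.coU hq (vL q k) (Y.D_vL1 hq k) l)
    have e : ∑ b, vL q k b * wU (q : ℂ) (z q) (zs q) l b
        = (q : ℂ) ^ 2 • ∑ b, vL q k b * dU q l b := by
      rw [Finset.smul_sum]
      exact Finset.sum_congr rfl fun b _ => mul_smul_comm _ _ _
    rw [e, map_smul, ← TensorProduct.smul_tmul']
    exact h
end Bim
end

/-! ### Part C6 -/

section
open Polynomial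
variable {q : ℝ} {W : Type} [AddCommGroup W] [Module ℂ W] [Module ℂ[X] W] (Y : Bim q W)

namespace Bim

/-- Passing to the opposite algebra in the second factor. -/
def opT (q : ℝ) : PA q ⊗[ℂ] HH q ≃ₗ[ℂ] PA q ⊗[ℂ] (HH q)ᵐᵒᵖ :=
  LinearEquiv.lTensor (PA q) (MulOpposite.opLinearEquiv ℂ)

lemma opT_tmul (p : PA q) (x : HH q) : opT q (p ⊗ₜ x) = p ⊗ₜ MulOpposite.op x := by
  simp [opT]

lemma opT_map (f : PA q →ₗ[ℂ] PA q) (φ : HH q →ₗ[ℂ] HH q) (ψ : (HH q)ᵐᵒᵖ →ₗ[ℂ] (HH q)ᵐᵒᵖ)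
    (h : ∀ x, MulOpposite.op (φ x) = ψ (MulOpposite.op x)) (w : PA q ⊗[ℂ] HH q) :
    opT q (TensorProduct.map f φ w) = TensorProduct.map f ψ (opT q w) := by
  induction w with
  | zero => simp only [map_zero]
  | add a b ha hb => simp only [map_add, ha, hb]
  | tmul p x => rw [TensorProduct.map_tmul, opT_tmul, opT_tmul, TensorProduct.map_tmul, h]

/-- The lower chart. -/
def chartL (hq : (q : ℂ) ≠ 0) : Chart (PA q) W (HH q)ᵐᵒᵖ where
  lm := Y.lm
  rm := Y.rm
  rm_one := Y.rm_one
  rm_mul := Y.rm_mul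
  lr := Y.lr
  e := Y.e
  D := (opT q).toLinearMap ∘ₗ Y.D
  D_one := by
    rw [LinearMap.comp_apply, Y.D_one]; exact opT_tmul 1 1
  coinv := fun b hb => Y.coinv b ((opT q).injective (by rw [opT_tmul]; exact hb))
  chi := (opT q).toLinearMap ∘ₗ Y.chi
  chi_eq := fun p' p => by
    rw [LinearMap.comp_apply, Y.chi_eq]
    exact opT_map _ _ _ (fun x => rfl) _
  span := Y.span
  R := RP q
  X_smul := Y.X_smul
  v := vL q
  vs := wL (q : ℂ) (z q) (zs q)
  o := vU q
  gen := fun M h1 hv ho p => PA_gen q hq M h1 ho hv p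
  h := fun a b => MulOpposite.op (hh q a b)
  hgen := fun M h1 hm x => by
    have := hh_gen_left q (M.comap (MulOpposite.opLinearEquiv ℂ).toLinearMap) h1
      (fun y hy a b => hm _ hy a b) x.unop
    exact this
  eps := epL (q : ℂ)
  lift := fun E _ _ m hr hc => hhop_lift q E m hr hc
  c := cL (q : ℂ)
  cc := inv_mul_cancel₀ (pow_ne_zero 2 hq)
  d := fun _ => 1
  d_ne := fun _ => one_ne_zero
  g := C 1 + C (-(q : ℂ) ^ 2) * X
  S := SL
  g_mem := by
    change eval 0 _ ≠ 0
    simp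
  S_sc := SL_sc
  lam := lamL (q : ℂ)
  mu := muL (q : ℂ)
  kap := kapL (q : ℂ)
  t := fun _ => 1
  Dv := fun p k a => by
    rw [LinearMap.comp_apply, D_vL q hq Y.D Y.hz Y.hs, map_sum]
    exact Finset.sum_congr rfl fun b _ => opT_map _ _ _ (fun x => rfl) _
  Do := fun p k a => by
    rw [LinearMap.comp_apply, D_vU q hq Y.D Y.hz Y.hs, map_sum]
    exact Finset.sum_congr rfl fun b _ => opT_map _ _ _ (fun x => rfl) _
  Rv := fun k a => (PA_sph q hq).L_Rv hq k a
  Rvs := fun k a => (PA_sph q hq).L_Rvs hq k a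
  Ro := fun k a => by rw [one_smul]; exact (PA_sph q hq).U_Rv hq k a
  vs_v := fun a b => by
    rw [aeval_lin, one_smul, neg_smul, ← sub_eq_add_neg, ← mul_one ((q : ℂ) ^ 2)]
    exact (PA_sph q hq).L_vs_v hq a b
  v_vs := fun a b => by
    rw [aeval_sc, one_smul, neg_mul, neg_smul, ← sub_eq_add_neg]
    exact (PA_sph q hq).L_v_vs hq a b
  rowv := fun a b => by
    rw [aeval_sc, one_smul, neg_mul, neg_smul, ← sub_eq_add_neg]
    exact (PA_sph q hq).L_rowv hq a b
  rowvs := fun a b => by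
    rw [aeval_lin, one_smul, neg_smul, ← sub_eq_add_neg, ← mul_one ((q : ℂ) ^ 2)]
    exact (PA_sph q hq).L_rowvs hq a b
  colvs := fun a b => by
    rw [aeval_sc, one_smul, neg_mul, neg_smul, ← sub_eq_add_neg]
    exact (PA_sph q hq).L_colvs hq a b
  colv := fun a b => by
    rw [aeval_lin, one_smul, neg_smul, ← sub_eq_add_neg, ← mul_one ((q : ℂ) ^ 2)]
    exact (PA_sph q hq).L_colv hq a b
  o_vs := fun k l a b => (PA_sph q hq).L_o_vs hq k l a b
  o_v := fun k l a b => by rw [one_smul]; exact (PA_sph q hq).L_o_v hq k l a b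
  t_g := fun k => by rw [one_smul, sc_one]
  b_coinv := fun k l => by
    have h := congrArg (fun x => opT q ((![1, (q : ℂ) ^ 2] : Fin 2 → ℂ) l • x))
      (Y.coL hq (vU q k) (Y.D_vU1 hq k) l)
    have e : ∑ b, vU q k b * wL (q : ℂ) (z q) (zs q) l b
        = (![1, (q : ℂ) ^ 2] : Fin 2 → ℂ) l • ∑ b, vU q k b * dL q l b := by
      rw [Finset.smul_sum]
      exact Finset.sum_congr rfl fun b _ => mul_smul_comm _ _ _
    rw [e, LinearMap.comp_apply, map_smul]
    refine h.trans ?_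
    rw [TensorProduct.smul_tmul']
    exact opT_tmul _ _

variable [IsScalarTower ℂ ℂ[X] W]

theorem inj (hq : (q : ℂ) ≠ 0) (w : W) (hw : Y.chi w = 0) : w = 0 := by
  obtain ⟨s, hs, h1⟩ := Chart.inj (Y.chartU hq) (Y.hR hq) w hw
  obtain ⟨t, ht, h2⟩ := Chart.inj (Y.chartL hq) (Y.hR hq) w
    (by change opT q (Y.chi w) = 0; rw [hw, map_zero])
  obtain ⟨a, b, hab⟩ := SU_SL s t hs ht
  rw [← one_smul ℂ[X] w, ← hab, add_smul, mul_smul, mul_smul, h1, h2, smul_zero, smul_zero,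
    add_zero]

theorem surj (hq : (q : ℂ) ≠ 0) : Function.Surjective Y.chi := by
  rw [← LinearMap.range_eq_top, eq_top_iff]
  rintro w -
  induction w with
  | zero => exact Submodule.zero_mem _
  | add a b ha hb => exact Submodule.add_mem _ ha hb
  | tmul p x =>
    obtain ⟨s, hs, h1⟩ := Chart.surj (Y.chartU hq) x
    obtain ⟨t, ht, h2⟩ := Chart.surj (Y.chartL hq) (MulOpposite.op x)
    have h2' : ∀ p, (p * aeval (RP q) t) ⊗ₜ[ℂ] x ∈ LinearMap.range Y.chi := fun p => by
      obtain ⟨w, hw⟩ := h2 p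
      refine ⟨w, (opT q).injective ?_⟩
      rw [opT_tmul]
      exact hw
    obtain ⟨a, b, hab⟩ := SU_SL s t hs ht
    have e : p = p * aeval (RP q) a * aeval (RP q) s + p * aeval (RP q) b * aeval (RP q) t := by
      rw [mul_assoc, mul_assoc, ← map_mul, ← map_mul, ← mul_add, ← map_add, hab, map_one, mul_one]
    rw [e, TensorProduct.add_tmul]
    exact Submodule.add_mem _ (h1 _) (h2' _)

theorem bij (hq : (q : ℂ) ≠ 0) : Function.Bijective Y.chi :=
  ⟨(injective_iff_map_eq_zero _).2 (Y.inj hq), Y.surj hq⟩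
end Bim
end

/-! ### Part D1 -/

section
open Polynomial
variable (q : ℝ) (δ : PA q →ₐ[ℂ] PA q ⊗[ℂ] AU q)

lemma lact_mk (p u v : PA q) : lact q δ p (mkT q δ (u ⊗ₜ v)) = mkT q δ ((p * u) ⊗ₜ v) := rfl
lemma ract_mk (p u v : PA q) : ract q δ p (mkT q δ (u ⊗ₜ v)) = mkT q δ (u ⊗ₜ (v * p)) := rfl

lemma PBP_ext (f g : Module.End ℂ (PBP q δ))
    (h : ∀ u v : PA q, f (mkT q δ (u ⊗ₜ v)) = g (mkT q δ (u ⊗ₜ v))) : f = g := by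
  refine LinearMap.ext fun w => ?_
  obtain ⟨w, rfl⟩ := Submodule.Quotient.mk_surjective _ w
  change f (mkT q δ w) = g (mkT q δ w)
  induction w with
  | zero => simp only [map_zero]
  | add a b ha hb => simp only [map_add, ha, hb]
  | tmul u v => exact h u v

/-- The left action as an algebra map. -/
def lmP : PA q →ₐ[ℂ] Module.End ℂ (PBP q δ) :=
  AlgHom.ofLinearMap
    { toFun := lact q δ
      map_add' := fun a b => PBP_ext q δ _ _ fun u v => by
        rw [LinearMap.add_apply, lact_mk, lact_mk, lact_mk, add_mul, TensorProduct.add_tmul,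
          map_add]
      map_smul' := fun c a => PBP_ext q δ _ _ fun u v => by
        rw [RingHom.id_apply, LinearMap.smul_apply, lact_mk, lact_mk, smul_mul_assoc,
          ← TensorProduct.smul_tmul', map_smul] }
    (PBP_ext q δ _ _ fun u v => by
      change lact q δ 1 _ = _
      rw [lact_mk, one_mul]; rfl)
    (fun a b => PBP_ext q δ _ _ fun u v => by
      rw [Module.End.mul_apply]
      change lact q δ (a * b) (mkT q δ (u ⊗ₜ v)) = lact q δ a (lact q δ b (mkT q δ (u ⊗ₜ v)))
      rw [lact_mk, lact_mk, lact_mk, mul_assoc])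

/-- The right action as a linear map. -/
def rmP : PA q →ₗ[ℂ] Module.End ℂ (PBP q δ) where
  toFun := ract q δ
  map_add' := fun a b => PBP_ext q δ _ _ fun u v => by
    rw [LinearMap.add_apply, ract_mk, ract_mk, ract_mk, mul_add, TensorProduct.tmul_add,
      map_add]
  map_smul' := fun c a => PBP_ext q δ _ _ fun u v => by
    rw [RingHom.id_apply, LinearMap.smul_apply, ract_mk, ract_mk, mul_smul_comm,
      TensorProduct.tmul_smul, map_smul]

lemma lmP_mk (p u v : PA q) : lmP q δ p (mkT q δ (u ⊗ₜ v)) = mkT q δ ((p * u) ⊗ₜ v) := rfl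
lemma rmP_mk (p u v : PA q) : rmP q δ p (mkT q δ (u ⊗ₜ v)) = mkT q δ (u ⊗ₜ (v * p)) := rfl

lemma balanced (b : PA q) (hb : b ∈ Bset q δ) (u v : PA q) :
    mkT q δ ((u * b) ⊗ₜ v) = mkT q δ (u ⊗ₜ (b * v)) := by
  rw [← sub_eq_zero, ← map_sub]
  exact (Submodule.Quotient.mk_eq_zero _).2 (Submodule.subset_span ⟨u, v, b, hb, rfl⟩)

/-- The polynomial action through right multiplication by `R`. -/
abbrev polyMod : Module ℂ[X] (PBP q δ) :=
  Module.compHom (PBP q δ) (aeval (rmP q δ (RP q)) : ℂ[X] →ₐ[ℂ] Module.End ℂ (PBP q δ)).toRingHom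

theorem main_aux (hq : (q : ℂ) ≠ 0) (S : AU q → AU q)
    (hSright : ∀ i j : Fin 4, ∑ k : Fin 4, tt q i k * S (tt q k j) = if i = j then 1 else 0)
    (hδz : ∀ i : Fin 4, δ (z q i) = ∑ j : Fin 4, z q j ⊗ₜ[ℂ] tt q j i)
    (hδzs : ∀ i : Fin 4, δ (zs q i) = ∑ j : Fin 4, zs q j ⊗ₜ[ℂ] S (tt q i j))
    (chi : PBP q δ →ₗ[ℂ] PA q ⊗[ℂ] Cq q)
    (hchi : ∀ p' p : PA q, chi (mkT q δ (p' ⊗ₜ[ℂ] p)) =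
      TensorProduct.map (LinearMap.mulLeft ℂ p') LinearMap.id (Dr q δ p)) :
    Function.Bijective chi := by
  obtain ⟨ρ, g, hρ, hg⟩ := exists_g q hq
  let G : PA q ⊗[ℂ] Cq q ≃ₗ[ℂ] PA q ⊗[ℂ] HH q := LinearEquiv.lTensor (PA q) g
  have hG : ∀ p x, G (p ⊗ₜ x) = p ⊗ₜ g x := fun p x => by simp [G]
  have hg1 : g (rr q 1) = 1 := by
    rw [hg, map_one ρ]; rfl
  have hGmap : ∀ (f : PA q →ₗ[ℂ] PA q) w, G (TensorProduct.map f LinearMap.id w) =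
      TensorProduct.map f LinearMap.id (G w) := by
    intro f w
    induction w with
    | zero => simp only [map_zero]
    | add a b ha hb => simp only [map_add, ha, hb]
    | tmul p x => rw [TensorProduct.map_tmul, hG, hG, TensorProduct.map_tmul]; rfl
  letI : Module ℂ[X] (PBP q δ) := polyMod q δ
  haveI : IsScalarTower ℂ ℂ[X] (PBP q δ) := ⟨fun c p w => by
    change aeval (rmP q δ (RP q)) (c • p) w = c • aeval (rmP q δ (RP q)) p w
    rw [map_smul, LinearMap.smul_apply]⟩
  have hD1 : Dr q δ 1 = 1 ⊗ₜ rr q 1 := by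
    change LinearMap.lTensor (PA q) (rr q) (δ 1) = _
    rw [map_one]; rfl
  let Y : Bim q (PBP q δ) :=
    { lm := lmP q δ
      rm := rmP q δ
      rm_one := PBP_ext q δ _ _ fun u v => by rw [rmP_mk, mul_one]; rfl
      rm_mul := fun a b w => by
        have : rmP q δ (a * b) = (rmP q δ b) * (rmP q δ a) := PBP_ext q δ _ _ fun u v => by
          rw [Module.End.mul_apply, rmP_mk, rmP_mk, rmP_mk, mul_assoc]
        rw [this]; rfl
      lr := fun a b w => by
        have : lmP q δ a * rmP q δ b = rmP q δ b * lmP q δ a := PBP_ext q δ _ _ fun u v => by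
          rw [Module.End.mul_apply, Module.End.mul_apply, rmP_mk, lmP_mk, lmP_mk, rmP_mk]
        exact congrArg (fun f : Module.End ℂ (PBP q δ) => f w) this
      e := mkT q δ (1 ⊗ₜ 1)
      D := DHm q δ g.toLinearMap
      D_one := by
        change G (Dr q δ 1) = _
        rw [hD1, hG, hg1]
      coinv := fun b hb => by
        have hb' : b ∈ Bset q δ := by
          apply G.injective
          rw [hG, hg1]; exact hb
        rw [lmP_mk, rmP_mk, mul_one, one_mul]
        have := balanced q δ b hb' 1 1
        rwa [one_mul, mul_one] at this
      chi := G.toLinearMap ∘ₗ chi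
      chi_eq := fun p' p => by
        rw [rmP_mk, lmP_mk, mul_one, one_mul]
        change G (chi _) = _
        rw [hchi, hGmap]; rfl
      span := fun w => by
        obtain ⟨w, rfl⟩ := Submodule.Quotient.mk_surjective _ w
        change mkT q δ w ∈ _
        induction w with
        | zero => rw [map_zero]; exact Submodule.zero_mem _
        | add a b ha hb => rw [map_add]; exact Submodule.add_mem _ ha hb
        | tmul u v =>
          refine Submodule.subset_span ⟨(u, v), ?_⟩
          change lmP q δ u (rmP q δ v _) = _
          rw [rmP_mk, lmP_mk, mul_one, one_mul]
      X_smul := fun w => by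
        change aeval (rmP q δ (RP q)) X w = _
        rw [aeval_X]
      hz := fun p i => by
        rw [DHm_mul q δ g.toLinearMap ρ hg (fun j => z q j) (fun j => tt q j i) (hδz i) p]
        simp only [hρ]
      hs := fun p i => by
        rw [DHm_mul q δ g.toLinearMap ρ hg (fun j => zs q j) (fun j => S (tt q i j)) (hδzs i) p]
        simp only [rho_S q hq ρ hρ S hSright] }
  have hb : Function.Bijective (fun w => G (chi w)) := Y.bij hq
  exact (Function.Bijective.of_comp_iff' G.bijective chi).1 hb
end

theorem canonical_map_bijective (q : ℝ) (hq0 : 0 < q) (hq1 : q < 1)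
    [StarRing (AU q)] [StarModule ℂ (AU q)]
    (S : AU q →ₗ[ℂ] AU q)
    (hSanti : ∀ x y : AU q, S (x * y) = S y * S x) (hS1 : S 1 = 1)
    (hSleft : ∀ i j : Fin 4, ∑ k : Fin 4, S (tt q i k) * tt q k j = if i = j then 1 else 0)
    (hSright : ∀ i j : Fin 4, ∑ k : Fin 4, tt q i k * S (tt q k j) = if i = j then 1 else 0)
    (hSD : S (Dq q) = dI q) (hSDi : S (dI q) = Dq q)
    (hstarT : ∀ i j : Fin 4, star (tt q i j) = S (tt q j i))
    (hstarD : star (Dq q) = dI q)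
    [StarRing (PA q)] [StarModule ℂ (PA q)]
    (hstarz : ∀ i : Fin 4, star (z q i) = zs q i)
    (δ : PA q →ₐ[ℂ] PA q ⊗[ℂ] AU q)
    (hδz : ∀ i : Fin 4, δ (z q i) = ∑ j : Fin 4, z q j ⊗ₜ[ℂ] tt q j i)
    (hδzs : ∀ i : Fin 4, δ (zs q i) = ∑ j : Fin 4, zs q j ⊗ₜ[ℂ] star (tt q j i))
    (chi : PBP q δ →ₗ[ℂ] PA q ⊗[ℂ] Cq q)
    (hchi : ∀ p' p : PA q, chi (mkT q δ (p' ⊗ₜ[ℂ] p)) =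
      TensorProduct.map (LinearMap.mulLeft ℂ p') LinearMap.id (Dr q δ p))
    : Function.Bijective chi := by
  have hq : (q : ℂ) ≠ 0 := by exact_mod_cast hq0.ne'
  refine main_aux q δ hq S hSright hδz ?_ chi hchi
  intro i
  rw [hδzs i]
  exact Finset.sum_congr rfl fun j _ => by rw [hstarT]

end QIB
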